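/- arXiv:1612.01363 — 3 statements merged into one kernel-verified Lean document; each statement's English description precedes it below -/
import Mathlib

section
/- Let a_1, ..., a_r and s_1 ≤ s_2 ≤ ... ≤ s_{r-1} and s_r be positive integers with a_1 < s_1 and a_i ≤ s_{i-1} for each 2 ≤ i ≤ r. Then for every ε > 0 there exists n_0 such that for all n ≥ n_0, every n-vertex K^{(r)}_{s_1,...,s_r}-free r-uniform hypergraph contains at most ((s_r - 1)^{(a_1⋯a_r)/(s_1⋯s_{r-1})} / (a_1! ⋯ a_r!) + ε) · n^{(a_1+⋯+a_r) - (a_1⋯a_r)/(s_1⋯s_{r-1})} copies of K^{(r)}_{a_1,...,a_r}. -/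
open scoped Classical in
/-- The homomorphisms from the complete partite hypergraph with parts `Fin (b i)` to the relation `R`. -/
noncomputable def partiteHoms {ι V : Type*} [Fintype ι] [Fintype V]
    (R : (ι → V) → Prop) (b : ι → ℕ) : Finset (∀ i, Fin (b i) → V) :=
  {f | ∀ g : ∀ i, Fin (b i), R fun i => f i (g i)}

open scoped Classical in
/-- The vertices that extend every transversal of the family `f` at the coordinate `i`. -/
noncomputable def commonNbrs {ι V : Type*} [DecidableEq ι] [Fintype V]
    (R : (ι → V) → Prop) (i : ι) {c : {j // j ≠ i} → ℕ} (f : ∀ j, Fin (c j) → V) : Finset V :=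
  {v | ∀ g : ∀ j, Fin (c j), R ((Equiv.funSplitAt i V).symm (v, fun j => f j (g j)))}

/-- The homomorphism density of a complete partite hypergraph in the relation `R`. -/
noncomputable def partiteDensity {ι V : Type*} [Fintype ι] [Fintype V]
    (R : (ι → V) → Prop) (b : ι → ℕ) : ℝ :=
  (partiteHoms R b).card / ∏ i, (Fintype.card V : ℝ) ^ b i

theorem partiteDensity_nonneg {ι V : Type*} [Fintype ι] [Fintype V]
    (R : (ι → V) → Prop) (b : ι → ℕ) : 0 ≤ partiteDensity R b := by
  unfold partiteDensity
  positivity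

section

variable {ι V : Type*} [Fintype ι] [DecidableEq ι] [Fintype V] (R : (ι → V) → Prop)

theorem mem_partiteHoms_iff_commonNbrs (i : ι) (b : ι → ℕ) (f : ∀ j, Fin (b j) → V) :
    f ∈ partiteHoms R b ↔
      ∀ p, f i p ∈ commonNbrs R i (c := fun j => b j) (fun j => f j) := by
  classical
  simp only [partiteHoms, commonNbrs, Finset.mem_filter, Finset.mem_univ, true_and]
  have key : ∀ g : ∀ j, Fin (b j), (Equiv.funSplitAt i V).symm
      (f i (g i), fun j : {j // j ≠ i} => f j (g j)) = fun j => f j (g j) := by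
    intro g
    rw [Equiv.symm_apply_eq]
    rfl
  constructor
  · intro h p g
    have := h ((Equiv.piSplitAt i fun j => Fin (b j)).symm (p, g))
    rw [← key] at this
    convert this using 3
    · simp
    · ext j
      simp [j.2]
  · intro h g
    rw [← key]
    exact h (g i) fun j => g j

open scoped Classical in
theorem card_filter_partiteHoms (i : ι) (b : ι → ℕ)
    (P : (∀ j : {j // j ≠ i}, Fin (b j) → V) → (Fin (b i) → V) → Prop) :
    ((partiteHoms R b).filter fun f => P (fun j => f j) (f i)).card =
      ∑ f' : ∀ j : {j // j ≠ i}, Fin (b j) → V,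
        (Finset.univ.filter fun x : Fin (b i) → V =>
          (∀ p, x p ∈ commonNbrs R i f') ∧ P f' x).card := by
  rw [← Finset.card_sigma]
  refine Finset.card_bij' (fun f _ => ⟨fun j => f j, f i⟩)
    (fun y _ => (Equiv.piSplitAt i fun j => Fin (b j) → V).symm (y.2, y.1)) ?_ ?_ ?_ ?_
  · intro f hf
    rw [Finset.mem_filter, mem_partiteHoms_iff_commonNbrs R i] at hf
    simpa using hf
  · rintro ⟨f', x⟩ hy
    have h1 : (fun j : {j // j ≠ i} => (Equiv.piSplitAt i fun j => Fin (b j) → V).symm (x, f') j)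
        = f' := by
      ext j
      simp [j.2]
    have h2 : (Equiv.piSplitAt i fun j => Fin (b j) → V).symm (x, f') i = x := by
      simp
    rw [Finset.mem_filter, mem_partiteHoms_iff_commonNbrs R i]
    simp only [h1, h2]
    simpa using hy
  · intro f hf
    exact (Equiv.piSplitAt i fun j => Fin (b j) → V).symm_apply_apply f
  · rintro ⟨f', x⟩ hy
    have := (Equiv.piSplitAt i fun j => Fin (b j) → V).apply_symm_apply (x, f')
    rw [Prod.ext_iff] at this
    exact Sigma.ext this.2 (heq_of_eq this.1)

theorem card_filter_forall_mem {k : ℕ} (D : Finset V) [DecidableEq V] :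
    (Finset.univ.filter fun x : Fin k → V => ∀ p, x p ∈ D).card = D.card ^ k := by
  have : (Finset.univ.filter fun x : Fin k → V => ∀ p, x p ∈ D) = Fintype.piFinset fun _ => D := by
    ext; simp
  rw [this]; simp

theorem card_partiteHoms (i : ι) (b : ι → ℕ) :
    (partiteHoms R b).card =
      ∑ f' : ∀ j : {j // j ≠ i}, Fin (b j) → V, (commonNbrs R i f').card ^ b i := by
  classical
  have := card_filter_partiteHoms R i b fun _ _ => True
  simpa [card_filter_forall_mem] using this

open scoped Classical in
theorem card_filter_not_injective_le {k : ℕ} (D : Finset V) :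
    (Finset.univ.filter fun x : Fin k → V => (∀ p, x p ∈ D) ∧ ¬ Function.Injective x).card ≤
      k ^ 2 * D.card ^ (k - 1) := by
  have hsub : (Finset.univ.filter fun x : Fin k → V =>
      (∀ p, x p ∈ D) ∧ ¬ Function.Injective x) ⊆
      (Finset.univ : Finset (Fin k × Fin k)).biUnion fun y => Finset.univ.filter fun x : Fin k → V =>
        (∀ p, x p ∈ D) ∧ y.1 ≠ y.2 ∧ x y.1 = x y.2 := by
    intro x hx
    obtain ⟨hx, hinj⟩ := (Finset.mem_filter.1 hx).2
    obtain ⟨p, q, hpq, hne⟩ := Function.not_injective_iff.1 hinj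
    simp only [Finset.mem_biUnion, Finset.mem_filter, Finset.mem_univ, true_and]
    exact ⟨(p, q), hx, hne, hpq⟩
  refine (Finset.card_le_card hsub).trans (Finset.card_biUnion_le.trans ?_)
  have : ∀ y : Fin k × Fin k, (Finset.univ.filter fun x : Fin k → V =>
      (∀ p, x p ∈ D) ∧ y.1 ≠ y.2 ∧ x y.1 = x y.2).card ≤ D.card ^ (k - 1) := by
    rintro ⟨p, q⟩
    have hcard : (Fintype.piFinset fun _ : {j : Fin k // j ≠ q} => D).card = D.card ^ (k - 1) := by
      simp
    rw [← hcard]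
    refine Finset.card_le_card_of_injOn (fun x j => x j) ?_ ?_
    · intro x hx
      simp at hx ⊢
      exact fun j _ => hx.1 j
    · intro x hx y hy hxy
      simp only [Finset.coe_filter, Set.mem_ofPred_eq, Finset.mem_univ, true_and] at hx hy
      ext j
      by_cases hj : j = q
      · subst hj
        rw [← hx.2.2, ← hy.2.2]
        exact congrFun hxy ⟨p, hx.2.1⟩
      · exact congrFun hxy ⟨j, hj⟩
  calc _ ≤ ∑ _y : Fin k × Fin k, D.card ^ (k - 1) := Finset.sum_le_sum fun y _ => this y
    _ = _ := by simp [sq]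

theorem card_partiteHoms_update (i : ι) (b : ι → ℕ) (k : ℕ) :
    (partiteHoms R (Function.update b i k)).card =
      ∑ f' : ∀ j : {j // j ≠ i}, Fin (b j) → V, (commonNbrs R i f').card ^ k := by
  rw [card_partiteHoms R i]
  have h : (fun j : {j // j ≠ i} => Function.update b i k j) = fun j : {j // j ≠ i} => b j := by
    ext j
    simp [j.2]
  have key : ∀ c c' : {j // j ≠ i} → ℕ, c = c' →
      ∑ f' : ∀ j : {j // j ≠ i}, Fin (c j) → V, (commonNbrs R i f').card ^ k =
      ∑ f' : ∀ j : {j // j ≠ i}, Fin (c' j) → V, (commonNbrs R i f').card ^ k := by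
    rintro c _ rfl
    rfl
  simpa using key _ _ h

open scoped Classical in
theorem card_filter_partiteHoms_not_injective_le (i : ι) (b : ι → ℕ) :
    ((partiteHoms R b).filter fun f => ¬ Function.Injective (f i)).card ≤
      b i ^ 2 * (partiteHoms R (Function.update b i (b i - 1))).card := by
  have h := card_filter_partiteHoms R i b fun _ x => ¬ Function.Injective x
  rw [card_partiteHoms_update, Finset.mul_sum]
  refine le_trans (le_of_eq ?_) (Finset.sum_le_sum fun f' _ => card_filter_not_injective_le _)
  convert h

theorem partiteDensity_update [Nonempty V] (i : ι) (b : ι → ℕ) (k : ℕ) :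
    partiteDensity R (Function.update b i k) =
      ∑ f' : ∀ j : {j // j ≠ i}, Fin (b j) → V,
        (∏ j : {j // j ≠ i}, (Fintype.card V : ℝ) ^ b j)⁻¹ *
          ((commonNbrs R i f').card / Fintype.card V : ℝ) ^ k := by
  have hV : (Fintype.card V : ℝ) ≠ 0 := by simp
  rw [partiteDensity, card_partiteHoms_update, ← Finset.mul_sum]
  have : ∏ j, (Fintype.card V : ℝ) ^ Function.update b i k j =
      (Fintype.card V : ℝ) ^ k * ∏ j : {j // j ≠ i}, (Fintype.card V : ℝ) ^ b j := by
    rw [Fintype.prod_eq_mul_prod_subtype_ne _ i]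
    congr 1
    · simp
    · exact Finset.prod_congr rfl fun j _ => by simp [j.2]
  rw [this]
  simp only [div_pow, ← Finset.sum_div]
  push_cast
  field_simp

theorem partiteDensity_update_le_rpow [Nonempty V] (i : ι) (b : ι → ℕ) {k l : ℕ}
    (hk : 0 < k) (hkl : k ≤ l) :
    partiteDensity R (Function.update b i k) ≤
      partiteDensity R (Function.update b i l) ^ ((k : ℝ) / l) := by
  have hl : 0 < l := hk.trans_le hkl
  have hk' : (0 : ℝ) < k := by exact_mod_cast hk
  have hl' : (0 : ℝ) < l := by exact_mod_cast hl
  have hp : (1 : ℝ) ≤ l / k := by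
    rw [one_le_div hk']
    exact_mod_cast hkl
  have hmean := Real.rpow_arith_mean_le_arith_mean_rpow
    (Finset.univ : Finset (∀ j : {j // j ≠ i}, Fin (b j) → V))
    (fun _ => (∏ j : {j // j ≠ i}, (Fintype.card V : ℝ) ^ b j)⁻¹)
    (fun f' => ((commonNbrs R i f').card / Fintype.card V : ℝ) ^ k)
    (fun _ _ => by positivity) (by simp [Finset.prod_ne_zero_iff]) (fun _ _ => by positivity) hp
  rw [← partiteDensity_update] at hmean
  have hpow : ∀ x : ℝ, 0 ≤ x → (x ^ k) ^ ((l : ℝ) / k) = x ^ l := by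
    intro x hx
    rw [← Real.rpow_natCast x k, ← Real.rpow_mul hx, mul_div_cancel₀ _ hk'.ne', Real.rpow_natCast]
  rw [Finset.sum_congr rfl fun f' _ => by rw [hpow _ (by positivity)],
    ← partiteDensity_update] at hmean
  have := Real.rpow_le_rpow (Real.rpow_nonneg (partiteDensity_nonneg R _) _) hmean
    (show 0 ≤ (k : ℝ) / l by positivity)
  rwa [← Real.rpow_mul (partiteDensity_nonneg R _), div_mul_div_cancel₀ hk'.ne',
    div_self hl'.ne', Real.rpow_one] at this

theorem partiteDensity_le_rpow [Nonempty V] {a b : ι → ℕ}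
    (ha : ∀ i, 0 < a i) (hab : ∀ i, a i ≤ b i) :
    partiteDensity R a ≤ partiteDensity R b ^ (∏ i, (a i : ℝ) / b i) := by
  suffices h : ∀ S : Finset ι, partiteDensity R a ≤
      partiteDensity R (S.piecewise b a) ^ (∏ i ∈ S, (a i : ℝ) / b i) by
    simpa using h Finset.univ
  intro S
  induction S using Finset.induction_on with
  | empty => simp
  | insert i S hi ih =>
    refine ih.trans ?_
    have hstep := partiteDensity_update_le_rpow R i (S.piecewise b a) (ha i) (hab i)
    have hself : Function.update (S.piecewise b a) i (a i) = S.piecewise b a := by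
      rw [Function.update_eq_self_iff]
      simp [hi]
    rw [hself, ← Finset.piecewise_insert] at hstep
    rw [Finset.prod_insert hi, Real.rpow_mul (partiteDensity_nonneg R _)]
    exact Real.rpow_le_rpow (partiteDensity_nonneg R _) hstep (by positivity)

end

theorem card_commonNbrs_lt_of_free {m n : ℕ} {s b : Fin (m + 1) → ℕ} {H : Finset (Finset (Fin n))}
    (hspos : ∀ i, 0 < s i) (hb : ∀ i : Fin m, b i.succ = s i.castSucc)
    (hcard : ∀ e ∈ H, e.card = m + 1)
    (hfree : ¬ ∃ A : Fin (m + 1) → Finset (Fin n),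
      (∀ i j, i ≠ j → Disjoint (A i) (A j)) ∧ (∀ i, (A i).card = s i) ∧
      ∀ g : Fin (m + 1) → Fin n, (∀ i, g i ∈ A i) → Finset.image g Finset.univ ∈ H)
    (f : ∀ j : {j : Fin (m + 1) // j ≠ 0}, Fin (b j) → Fin n)
    (hf : ∀ j, Function.Injective (f j)) :
    (commonNbrs (fun x : Fin (m + 1) → Fin n => Finset.image x Finset.univ ∈ H) 0 f).card <
      s (Fin.last m) := by
  by_contra! hle
  obtain ⟨B, hB, hBcard⟩ := Finset.exists_subset_card_eq hle
  set A : Fin (m + 1) → Finset (Fin n) :=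
    Fin.snoc (fun i : Fin m => Finset.univ.image (f ⟨i.succ, Fin.succ_ne_zero i⟩)) B with hA
  have hAcast : ∀ i : Fin m,
      A i.castSucc = Finset.univ.image (f ⟨i.succ, Fin.succ_ne_zero i⟩) := fun i => by
    simp [hA]
  have hAlast : A (Fin.last m) = B := by simp [hA]
  have hAcard : ∀ i, (A i).card = s i := by
    intro i
    induction i using Fin.lastCases with
    | last => rw [hAlast, hBcard]
    | cast i => rw [hAcast, Finset.card_image_of_injective _ (hf _), Finset.card_fin, hb]
  have hedge : ∀ g : Fin (m + 1) → Fin n, (∀ i, g i ∈ A i) → Finset.image g Finset.univ ∈ H := by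
    intro g hg
    have hex : ∀ j : {j : Fin (m + 1) // j ≠ 0}, ∃ p, f j p = g (j.1.pred j.2).castSucc := by
      rintro ⟨j, hj⟩
      obtain ⟨i, rfl⟩ := Fin.exists_succ_eq.2 hj
      have := hg i.castSucc
      rw [hAcast] at this
      simpa using this
    choose p hp using hex
    have hlast := hB (hAlast ▸ hg (Fin.last m))
    simp only [commonNbrs, Finset.mem_filter, Finset.mem_univ, true_and] at hlast
    have := hlast p
    simp only [hp] at this
    convert this using 1
    ext v
    simp only [Finset.mem_image, Finset.mem_univ, true_and]
    rw [Fin.exists_fin_succ', Fin.exists_fin_succ, or_comm]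
    simp
  refine hfree ⟨A, fun i j hij => ?_, hAcard, hedge⟩
  have hne : ∀ k, (A k).Nonempty := fun k => Finset.card_pos.1 (by rw [hAcard]; exact hspos k)
  choose x hx using hne
  rw [Finset.disjoint_left]
  intro v hvi hvj
  have hmem := hedge (Function.update (Function.update x i v) j v) (by
    intro k
    by_cases hkj : k = j
    · subst hkj; simpa using hvj
    · by_cases hki : k = i
      · subst hki; simpa [hkj] using hvi
      · simpa [hkj, hki] using hx k)
  have hinj := Finset.card_image_iff.1 ((hcard _ hmem).trans (Finset.card_fin _).symm)
  exact hij (hinj (by simp) (by simp) (by simp [hij]))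

theorem card_partiteHoms_le_of_free {m n : ℕ} {s b : Fin (m + 1) → ℕ} {H : Finset (Finset (Fin n))}
    (hspos : ∀ i, 0 < s i) (hb : ∀ i : Fin m, b i.succ = s i.castSucc)
    (hcard : ∀ e ∈ H, e.card = m + 1)
    (hfree : ¬ ∃ A : Fin (m + 1) → Finset (Fin n),
      (∀ i j, i ≠ j → Disjoint (A i) (A j)) ∧ (∀ i, (A i).card = s i) ∧
      ∀ g : Fin (m + 1) → Fin n, (∀ i, g i ∈ A i) → Finset.image g Finset.univ ∈ H) :
    (partiteHoms (fun x : Fin (m + 1) → Fin n => Finset.image x Finset.univ ∈ H) b).card ≤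
      (∏ i : Fin m, n ^ b i.succ) * (s (Fin.last m) - 1) ^ b 0 +
        ∑ i : Fin m, b i.succ ^ 2 *
          (partiteHoms (fun x : Fin (m + 1) → Fin n => Finset.image x Finset.univ ∈ H)
            (Function.update b i.succ (b i.succ - 1))).card := by
  classical
  set R : (Fin (m + 1) → Fin n) → Prop := fun x => Finset.image x Finset.univ ∈ H with hR
  have hsub : partiteHoms R b ⊆
      ((partiteHoms R b).filter fun f => ∀ j : {j : Fin (m + 1) // j ≠ 0},
        Function.Injective (f j)) ∪
      (Finset.univ : Finset (Fin m)).biUnion fun i =>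
        (partiteHoms R b).filter fun f => ¬ Function.Injective (f i.succ) := by
    intro f hf
    by_cases h : ∀ j : {j : Fin (m + 1) // j ≠ 0}, Function.Injective (f j)
    · exact Finset.mem_union_left _ (Finset.mem_filter.2 ⟨hf, h⟩)
    · push Not at h
      obtain ⟨⟨j, hj⟩, hinj⟩ := h
      obtain ⟨i, rfl⟩ := Fin.exists_succ_eq.2 hj
      exact Finset.mem_union_right _
        (Finset.mem_biUnion.2 ⟨i, Finset.mem_univ _, Finset.mem_filter.2 ⟨hf, hinj⟩⟩)
  refine (Finset.card_le_card hsub).trans ((Finset.card_union_le _ _).trans (add_le_add ?_ ?_))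
  · have h := card_filter_partiteHoms R 0 b fun f' _ => ∀ j, Function.Injective (f' j)
    refine le_of_eq_of_le (by congr!) (h.trans_le ?_)
    calc _ ≤ ∑ _f' : ∀ j : {j : Fin (m + 1) // j ≠ 0}, Fin (b j) → Fin n,
          (s (Fin.last m) - 1) ^ b 0 := by
            refine Finset.sum_le_sum fun f' _ => ?_
            by_cases hf' : ∀ j, Function.Injective (f' j)
            · simp only [hf', implies_true, and_true]
              rw [card_filter_forall_mem]
              exact Nat.pow_le_pow_left
                (Nat.le_sub_one_of_lt (card_commonNbrs_lt_of_free hspos hb hcard hfree f' hf')) _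
            · simp only [hf', and_false]
              simp
      _ = _ := by
            have hsplit : ∏ j : {j : Fin (m + 1) // j ≠ 0}, n ^ b j = ∏ i : Fin m, n ^ b i.succ :=
              Fintype.prod_equiv (finSuccAboveEquiv (0 : Fin (m + 1))).symm _ _ (by
                rintro ⟨j, hj⟩
                obtain ⟨i, rfl⟩ := Fin.exists_succ_eq.2 hj
                congr 2)
            simp [hsplit]
  · exact Finset.card_biUnion_le.trans
      (Finset.sum_le_sum fun i _ =>
        le_of_eq_of_le (by congr!) (card_filter_partiteHoms_not_injective_le R i.succ b))

/-- Each copy of the complete partite hypergraph arises from at least `∏ i, (a i)!`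
homomorphisms. -/
theorem card_copies_mul_prod_factorial_le {m n : ℕ} (a : Fin (m + 1) → ℕ)
    (H : Finset (Finset (Fin n))) :
    Nat.card {P : Finset (Finset (Fin n)) //
        ∃ A : Fin (m + 1) → Finset (Fin n),
          P = Finset.image A Finset.univ ∧
          (∀ i j, i ≠ j → Disjoint (A i) (A j)) ∧ (∀ i, (A i).card = a i) ∧
          ∀ g : Fin (m + 1) → Fin n, (∀ i, g i ∈ A i) → Finset.image g Finset.univ ∈ H} *
      ∏ i, (a i).factorial ≤
    (partiteHoms (fun x : Fin (m + 1) → Fin n => Finset.image x Finset.univ ∈ H) a).card := by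
  classical
  set R : (Fin (m + 1) → Fin n) → Prop := fun x => Finset.image x Finset.univ ∈ H with hR
  set Copy := {P : Finset (Finset (Fin n)) //
        ∃ A : Fin (m + 1) → Finset (Fin n),
          P = Finset.image A Finset.univ ∧
          (∀ i j, i ≠ j → Disjoint (A i) (A j)) ∧ (∀ i, (A i).card = a i) ∧
          ∀ g : Fin (m + 1) → Fin n, (∀ i, g i ∈ A i) → Finset.image g Finset.univ ∈ H}
  choose A hP hdisj hcard hedge using fun P : Copy => P.2
  have hlabel : ∀ P : Copy, Fintype.card (∀ i, Fin (a i) ≃ A P i) = ∏ i, (a i).factorial := by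
    intro P
    rw [Fintype.card_pi]
    refine Finset.prod_congr rfl fun i _ => ?_
    rw [Fintype.card_equiv (Fintype.equivOfCardEq (by simp [hcard P i])), Fintype.card_fin]
  have hdom : Fintype.card (Σ P : Copy, ∀ i, Fin (a i) ≃ A P i) =
      Nat.card Copy * ∏ i, (a i).factorial := by
    simp [Fintype.card_sigma, hlabel]
  rw [← hdom, ← Fintype.card_coe (partiteHoms R a)]
  refine Fintype.card_le_of_injective
    (fun y => ⟨fun i p => (y.2 i p : Fin n), ?_⟩) ?_
  · simp only [partiteHoms, Finset.mem_filter, Finset.mem_univ, true_and]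
    exact fun g => hedge y.1 _ fun i => (y.2 i (g i)).2
  · rintro ⟨P, e⟩ ⟨Q, e'⟩ h
    have hfun : ∀ i p, (e i p : Fin n) = e' i p := fun i p =>
      congrFun (congrFun (congrArg Subtype.val h) i) p
    have hmem : ∀ (P : Copy) (e : ∀ i, Fin (a i) ≃ A P i) i v,
        v ∈ A P i ↔ ∃ p, (e i p : Fin n) = v := by
      intro P e i v
      constructor
      · intro hv
        exact ⟨(e i).symm ⟨v, hv⟩, by simp⟩
      · rintro ⟨p, rfl⟩
        exact (e i p).2
    have hA : A P = A Q := by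
      ext i v
      simp only [hmem P e, hmem Q e', hfun]
    obtain rfl : P = Q := Subtype.ext (by rw [hP P, hP Q, hA])
    congr
    ext i p
    rw [hfun]

theorem exists_forall_rpow_le_of_le_add_mul_max {C K δ p η : ℝ} (hC : 0 ≤ C) (hK : 0 ≤ K)
    (hδ : 0 < δ) (hp : 0 < p) (hη : 0 < η) :
    ∃ n₀ : ℕ, ∀ n ≥ n₀, ∀ τ : ℝ, 0 ≤ τ → τ ≤ C + K * (n : ℝ) ^ (-δ) * max 1 τ →
      τ ^ p ≤ C ^ p + η := by
  have hcont : Filter.Tendsto (fun x : ℝ => (C + x * (2 * C + 2)) ^ p) (nhds 0) (nhds (C ^ p)) := by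
    have : ContinuousAt (fun x : ℝ => (C + x * (2 * C + 2)) ^ p) 0 :=
      ContinuousAt.rpow_const (by fun_prop) (Or.inr hp.le)
    simpa [ContinuousAt] using this
  have hlim : Filter.Tendsto (fun n : ℕ => K * (n : ℝ) ^ (-δ)) Filter.atTop (nhds 0) := by
    simpa using ((tendsto_rpow_neg_atTop hδ).comp tendsto_natCast_atTop_atTop).const_mul K
  have h1 := (hcont.comp hlim).eventually (eventually_le_nhds (lt_add_of_pos_right (C ^ p) hη))
  have h2 := hlim.eventually (eventually_le_nhds (show (0 : ℝ) < 1 / 2 by norm_num))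
  obtain ⟨n₀, hn₀⟩ := Filter.eventually_atTop.1 (h1.and h2)
  refine ⟨n₀, fun n hn τ hτ hle => ?_⟩
  obtain ⟨hpow, hhalf⟩ := hn₀ n hn
  have hnn : 0 ≤ K * (n : ℝ) ^ (-δ) := by positivity
  have hmax : max 1 τ ≤ 1 + τ := max_le (by linarith) (by linarith)
  have hτ' : max 1 τ ≤ 2 * C + 2 := by
    have : K * (n : ℝ) ^ (-δ) * max 1 τ ≤ 1 / 2 * (1 + τ) :=
      mul_le_mul hhalf hmax (by positivity) (by norm_num)
    exact max_le (by linarith) (by linarith)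
  refine le_trans (Real.rpow_le_rpow hτ ?_ hp.le) hpow
  exact hle.trans (by gcongr)

/-- The rescaled density `τ` of the complete partite hypergraph with parts of sizes
`a₀, s₀, …, s_{m-1}` in a free hypergraph almost satisfies `τ ≤ (s_m - 1) ^ a₀`. -/
theorem partiteDensity_mul_pow_le_of_free {m n a₀ : ℕ} {s b : Fin (m + 1) → ℕ}
    {H : Finset (Finset (Fin n))} (hn : 0 < n) (ha₀ : 0 < a₀)
    (hspos : ∀ i, 0 < s i) (hb0 : b 0 = a₀) (hb : ∀ i : Fin m, b i.succ = s i.castSucc)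
    (hs0 : ∀ i : Fin m, s 0 ≤ s i.castSucc) (h1 : a₀ < s 0)
    (hcard : ∀ e ∈ H, e.card = m + 1)
    (hfree : ¬ ∃ A : Fin (m + 1) → Finset (Fin n),
      (∀ i j, i ≠ j → Disjoint (A i) (A j)) ∧ (∀ i, (A i).card = s i) ∧
      ∀ g : Fin (m + 1) → Fin n, (∀ i, g i ∈ A i) → Finset.image g Finset.univ ∈ H)
    {τ : ℝ} (hτ : τ = partiteDensity
      (fun x : Fin (m + 1) → Fin n => Finset.image x Finset.univ ∈ H) b * (n : ℝ) ^ a₀) :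
    τ ≤ ((s (Fin.last m) : ℝ) - 1) ^ a₀ +
      (∑ i : Fin m, (s i.castSucc : ℝ) ^ 2) * (n : ℝ) ^ (-(1 - (a₀ : ℝ) / s 0)) * max 1 τ := by
  have : Nonempty (Fin n) := ⟨⟨0, hn⟩⟩
  have hn' : (0 : ℝ) < n := by exact_mod_cast hn
  set R : (Fin (m + 1) → Fin n) → Prop := fun x => Finset.image x Finset.univ ∈ H with hR
  have hτ0 : 0 ≤ τ := hτ ▸ mul_nonneg (partiteDensity_nonneg R b) (by positivity)
  set Q : ℝ := ∏ i : Fin m, (n : ℝ) ^ b i.succ with hQ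
  have hQ0 : 0 < Q := Finset.prod_pos fun i _ => by positivity
  have hbprod : ∏ i, (n : ℝ) ^ b i = n ^ a₀ * Q := by rw [Fin.prod_univ_succ, hb0]
  have hN : ((partiteHoms R b).card : ℝ) = τ * Q := by
    rw [hτ, partiteDensity, Fintype.card_fin, hbprod]
    field_simp
  have hs2 : ∀ i : Fin m, 2 ≤ s i.castSucc := fun i => by
    have := hs0 i
    omega
  have hNupdate : ∀ i : Fin m,
      ((partiteHoms R (Function.update b i.succ (b i.succ - 1))).card : ℝ) ≤
        (n : ℝ) ^ (-(1 - (a₀ : ℝ) / s 0)) * max 1 τ * Q := by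
    intro i
    set k := s i.castSucc with hk
    have hk2 : (2 : ℝ) ≤ k := by exact_mod_cast hs2 i
    have hdens := partiteDensity_update_le_rpow R i.succ b (k := k - 1) (l := k)
      (by have := hs2 i; omega) (Nat.sub_le _ _)
    have hself : Function.update b i.succ k = b := by
      rw [Function.update_eq_self_iff, hb]
    rw [hself] at hdens
    have hprod : ∏ j, (n : ℝ) ^ Function.update b i.succ (k - 1) j = n ^ a₀ * Q / n := by
      have hne : ∀ j, (n : ℝ) ^ b j ≠ 0 := fun j => by positivity
      rw [← hbprod, Fintype.prod_eq_mul_prod_compl i.succ, Fintype.prod_eq_mul_prod_compl i.succ,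
        Function.update_self, hb, ← hk, Finset.prod_congr rfl fun j hj => by
          rw [Function.update_of_ne (by simpa using hj)]]
      have : (n : ℝ) ^ k = n ^ (k - 1) * n := by
        rw [← pow_succ, Nat.sub_add_cancel (by have := hs2 i; omega)]
      rw [this]
      field_simp
    have hcardeq : ((partiteHoms R (Function.update b i.succ (b i.succ - 1))).card : ℝ) =
        partiteDensity R (Function.update b i.succ (k - 1)) * (n ^ a₀ * Q / n) := by
      rw [partiteDensity, Fintype.card_fin, hprod, hb, ← hk]
      field_simp
    have hdens_eq : partiteDensity R b = τ * (n : ℝ) ^ (-(a₀ : ℝ)) := by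
      rw [hτ, Real.rpow_neg hn'.le, Real.rpow_natCast]
      field_simp
    have hcast : ((k - 1 : ℕ) : ℝ) / k = 1 - 1 / k := by
      rw [Nat.cast_sub (by have := hs2 i; omega)]
      field_simp
      simp
    have hexp : 0 ≤ 1 - 1 / (k : ℝ) := by
      rw [sub_nonneg, div_le_one (by linarith)]
      linarith
    have hτpow : τ ^ (1 - 1 / (k : ℝ)) ≤ max 1 τ := by
      refine (Real.rpow_le_rpow hτ0 (le_max_right 1 τ) hexp).trans ?_
      refine Real.rpow_le_self_of_one_le (le_max_left 1 τ) ?_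
      have : 0 ≤ 1 / (k : ℝ) := by positivity
      linarith
    have hnpow : (n : ℝ) ^ ((a₀ : ℝ) / k - 1) ≤ (n : ℝ) ^ (-(1 - (a₀ : ℝ) / s 0)) := by
      refine Real.rpow_le_rpow_of_exponent_le (by exact_mod_cast hn) ?_
      have hs0' : (0 : ℝ) < s 0 := by exact_mod_cast hspos 0
      have : (a₀ : ℝ) / k ≤ a₀ / s 0 :=
        div_le_div_of_nonneg_left (by positivity) hs0' (by exact_mod_cast hs0 i)
      linarith
    rw [hcast, hdens_eq, Real.mul_rpow hτ0 (by positivity), ← Real.rpow_mul hn'.le] at hdens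
    calc _ ≤ τ ^ (1 - 1 / (k : ℝ)) * (n : ℝ) ^ (-(a₀ : ℝ) * (1 - 1 / k)) * (n ^ a₀ * Q / n) := by
            rw [hcardeq]
            gcongr
      _ = τ ^ (1 - 1 / (k : ℝ)) * (n : ℝ) ^ ((a₀ : ℝ) / k - 1) * Q := by
            have : (n : ℝ) ^ ((a₀ : ℝ) / k - 1) =
                (n : ℝ) ^ (-(a₀ : ℝ) * (1 - 1 / k)) * n ^ a₀ / n := by
              rw [← Real.rpow_natCast, ← Real.rpow_add hn', ← Real.rpow_sub_one hn'.ne']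
              congr 1
              ring
            rw [this]
            ring
      _ ≤ max 1 τ * (n : ℝ) ^ (-(1 - (a₀ : ℝ) / s 0)) * Q := by gcongr
      _ = _ := by ring
  have hmain : ((partiteHoms R b).card : ℝ) ≤ Q * ((s (Fin.last m) : ℝ) - 1) ^ a₀ +
      ∑ i : Fin m, (s i.castSucc : ℝ) ^ 2 *
        ((partiteHoms R (Function.update b i.succ (b i.succ - 1))).card : ℝ) := by
    have h := card_partiteHoms_le_of_free hspos hb hcard hfree
    rw [← hR] at h
    have h' : ((partiteHoms R b).card : ℝ) ≤ _ := Nat.cast_le.2 h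
    push_cast [Nat.cast_sub (hspos (Fin.last m))] at h'
    simpa only [hQ, hb0, hb] using h'
  refine le_of_mul_le_mul_right ?_ hQ0
  rw [← hN]
  calc _ ≤ _ := hmain
    _ ≤ Q * ((s (Fin.last m) : ℝ) - 1) ^ a₀ + ∑ i : Fin m, (s i.castSucc : ℝ) ^ 2 *
        ((n : ℝ) ^ (-(1 - (a₀ : ℝ) / s 0)) * max 1 τ * Q) := by
          gcongr with i
          exact hNupdate i
    _ = _ := by
          rw [← Finset.sum_mul]
          ring

/-- Main upper bound (Lemma 3.1): in an `n`-vertex `K^{(r)}_{s_1,…,s_r}`-free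
`r`-uniform hypergraph (`r = m+1`), the number of (unordered) copies of
`K^{(r)}_{a_1,…,a_r}` is at most
`((s_r-1)^{E}/(a_1!⋯a_r!) + ε) · n^{(a_1+⋯+a_r) - E}` where
`E = a_1⋯a_r/(s_1⋯s_{r-1})`, for `n` large. -/
theorem count_complete_partite_in_free_hypergraph
    (m : ℕ) (hm : 1 ≤ m) (a s : Fin (m + 1) → ℕ)
    (ha : ∀ i, 0 < a i) (hspos : ∀ i, 0 < s i)
    (hmono : ∀ i j : Fin m, i ≤ j → s i.castSucc ≤ s j.castSucc)
    (h1 : a 0 < s 0) (h2 : ∀ i : Fin m, a i.succ ≤ s i.castSucc)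
    (ε : ℝ) (hε : 0 < ε) :
    ∃ n₀ : ℕ, ∀ n ≥ n₀, ∀ H : Finset (Finset (Fin n)),
      (∀ e ∈ H, e.card = m + 1) →
      (¬ ∃ A : Fin (m + 1) → Finset (Fin n),
          (∀ i j, i ≠ j → Disjoint (A i) (A j)) ∧ (∀ i, (A i).card = s i) ∧
          ∀ g : Fin (m + 1) → Fin n, (∀ i, g i ∈ A i) →
            Finset.image g Finset.univ ∈ H) →
      (Nat.card {P : Finset (Finset (Fin n)) //
          ∃ A : Fin (m + 1) → Finset (Fin n),
            P = Finset.image A Finset.univ ∧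
            (∀ i j, i ≠ j → Disjoint (A i) (A j)) ∧ (∀ i, (A i).card = a i) ∧
            ∀ g : Fin (m + 1) → Fin n, (∀ i, g i ∈ A i) →
              Finset.image g Finset.univ ∈ H} : ℝ) ≤
        (((s (Fin.last m) : ℝ) - 1) ^
            ((∏ i, (a i : ℝ)) / ∏ i : Fin m, (s i.castSucc : ℝ)) /
            (∏ i, (Nat.factorial (a i) : ℝ)) + ε) *
          (n : ℝ) ^
            ((∑ i, (a i : ℝ)) -
              (∏ i, (a i : ℝ)) / ∏ i : Fin m, (s i.castSucc : ℝ)) := by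
  set E : ℝ := (∏ i, (a i : ℝ)) / ∏ i : Fin m, (s i.castSucc : ℝ) with hE
  set F : ℝ := ∏ i, (Nat.factorial (a i) : ℝ) with hF
  have hF0 : 0 < F := Finset.prod_pos fun i _ => by positivity
  have hcastpos : ∀ i, (0 : ℝ) < a i := fun i => by exact_mod_cast ha i
  have hscast : ∀ i, (0 : ℝ) < s i := fun i => by exact_mod_cast hspos i
  have hE0 : 0 < E :=
    div_pos (Finset.prod_pos fun i _ => hcastpos i) (Finset.prod_pos fun i _ => hscast _)
  have hs0 : ∀ i : Fin m, s 0 ≤ s i.castSucc := fun i => by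
    simpa using hmono ⟨0, hm⟩ i (Nat.zero_le _)
  have hlast : (0 : ℝ) ≤ (s (Fin.last m) : ℝ) - 1 := by
    have : (1 : ℝ) ≤ s (Fin.last m) := by exact_mod_cast hspos (Fin.last m)
    linarith
  have hδ : 0 < 1 - (a 0 : ℝ) / s 0 := by
    rw [sub_pos, div_lt_one (hscast 0)]
    exact_mod_cast h1
  obtain ⟨n₀, hn₀⟩ := exists_forall_rpow_le_of_le_add_mul_max
    (C := ((s (Fin.last m) : ℝ) - 1) ^ a 0) (K := ∑ i : Fin m, (s i.castSucc : ℝ) ^ 2)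
    (p := E / a 0) (η := ε * F) (by positivity) (by positivity) hδ
    (div_pos hE0 (hcastpos 0)) (mul_pos hε hF0)
  refine ⟨max n₀ 1, fun n hn H hcard hfree => ?_⟩
  have hnpos : 0 < n := (le_max_right n₀ 1).trans hn
  have hn' : (0 : ℝ) < n := by exact_mod_cast hnpos
  have : Nonempty (Fin n) := ⟨⟨0, hnpos⟩⟩
  set b : Fin (m + 1) → ℕ := Fin.cons (a 0) fun i => s i.castSucc with hb
  set R : (Fin (m + 1) → Fin n) → Prop := fun x => Finset.image x Finset.univ ∈ H with hR
  have hτ := partiteDensity_mul_pow_le_of_free (a₀ := a 0) (b := b) hnpos (ha 0) hspos rfl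
    (fun _ => rfl) hs0 h1 hcard hfree rfl
  rw [← hR] at hτ
  have hτE := hn₀ n ((le_max_left n₀ 1).trans hn) _
    (mul_nonneg (partiteDensity_nonneg R b) (by positivity)) hτ
  have hab : ∀ i, a i ≤ b i := fun i => by
    induction i using Fin.cases with
    | zero => exact le_rfl
    | succ i => exact h2 i
  have hexp : ∏ i, (a i : ℝ) / b i = E / a 0 := by
    have hb_prod : ∏ i, (b i : ℝ) = a 0 * ∏ i : Fin m, (s i.castSucc : ℝ) := by
      simp [Fin.prod_univ_succ, hb]
    rw [Finset.prod_div_distrib, hb_prod, hE, div_div, mul_comm]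
  have hC : (((s (Fin.last m) : ℝ) - 1) ^ a 0) ^ (E / a 0) = ((s (Fin.last m) : ℝ) - 1) ^ E := by
    rw [← Real.rpow_natCast, ← Real.rpow_mul hlast, mul_div_cancel₀ _ (hcastpos 0).ne']
  have hna : ((n : ℝ) ^ a 0) ^ (E / a 0) = (n : ℝ) ^ E := by
    rw [← Real.rpow_natCast, ← Real.rpow_mul hn'.le, mul_div_cancel₀ _ (hcastpos 0).ne']
  rw [hC, Real.mul_rpow (partiteDensity_nonneg R b) (by positivity), hna] at hτE
  have hdens := partiteDensity_le_rpow R ha hab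
  rw [hexp] at hdens
  have hcopies := card_copies_mul_prod_factorial_le a H
  rw [← hR] at hcopies
  have hcopies' := (Nat.cast_le (α := ℝ)).2 hcopies
  push_cast at hcopies'
  have hhoms : ((partiteHoms R a).card : ℝ) = partiteDensity R a * (n : ℝ) ^ (∑ i, (a i : ℝ)) := by
    have hsum : (n : ℝ) ^ (∑ i, (a i : ℝ)) = ∏ i, (n : ℝ) ^ a i := by
      rw [Real.rpow_sum_of_pos hn']
      simp
    rw [hsum, partiteDensity, Fintype.card_fin, div_mul_cancel₀]
    exact Finset.prod_ne_zero_iff.2 fun i _ => by positivity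
  refine le_of_mul_le_mul_right ?_ hF0
  calc _ ≤ _ := hcopies'
    _ = partiteDensity R a * (n : ℝ) ^ (∑ i, (a i : ℝ)) := hhoms
    _ ≤ partiteDensity R b ^ (E / a 0) * (n : ℝ) ^ (∑ i, (a i : ℝ)) := by gcongr
    _ = partiteDensity R b ^ (E / a 0) * (n : ℝ) ^ E * (n : ℝ) ^ ((∑ i, (a i : ℝ)) - E) := by
          rw [mul_assoc, ← Real.rpow_add hn', add_sub_cancel]
    _ ≤ (((s (Fin.last m) : ℝ) - 1) ^ E + ε * F) * (n : ℝ) ^ ((∑ i, (a i : ℝ)) - E) := by gcongr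
    _ = _ := by
          field_simp
end

section
/- Let s_1, ..., s_{r-1} be positive integers and H an r-uniform hypergraph with v vertices and e edges. Then there exists a constant c (depending only on s_1,...,s_{r-1} and H) such that for every integer p ≥ c and infinitely many n, there exists an n-vertex r-uniform hypergraph G that is K^{(r)}_{s_1,...,s_{r-1},p}-free and contains at least Ω(n^{v - e/(s_1 s_2 ⋯ s_{r-1})}) copies of H. -/
/-- A `k`-uniform hypergraph `G` contains a copy of the complete `k`-partite
hypergraph with part sizes `sz`. -/
def ContainsCompletePartite {V : Type*} [DecidableEq V]
    (G : Finset (Finset V)) {k : ℕ} (sz : Fin k → ℕ) : Prop :=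
  ∃ A : Fin k → Finset V, (∀ i j, i ≠ j → Disjoint (A i) (A j)) ∧
    (∀ i, (A i).card = sz i) ∧
    ∀ g : Fin k → V, (∀ i, g i ∈ A i) → Finset.image g Finset.univ ∈ G

namespace RandomAlgebraic

open MvPolynomial

section Elimination

variable {σ F : Type} [Field F]

/-- Polynomial substitution by elements of filtration level one respects the filtration. -/
theorem aeval_mem_filtration {B : Type*} [CommRing B] [Algebra F B] (P : ℕ → B → Prop)
    (hmono : ∀ {a b x}, a ≤ b → P a x → P b x)
    (hadd : ∀ {a x y}, P a x → P a y → P a (x + y))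
    (hconst : ∀ c : F, P 0 (algebraMap F B c))
    (hmul : ∀ {a b x y}, P a x → P b y → P (a + b) (x * y))
    (φ : σ → B) (hφ : ∀ i, P 1 (φ i)) (f : MvPolynomial σ F) :
    P f.totalDegree (aeval φ f) := by
  have hone : P 0 (1 : B) := by simpa using hconst 1
  have hzero : ∀ n, P n (0 : B) := fun n => hmono (Nat.zero_le n) (by simpa using hconst 0)
  have hpow : ∀ i k, P k (φ i ^ k) := by
    intro i k
    induction k with
    | zero => simpa using hone
    | succ k ih => rw [pow_succ]; exact hmul ih (hφ i)
  have hprod : ∀ (d : σ →₀ ℕ) (T : Finset σ), P (∑ i ∈ T, d i) (∏ i ∈ T, φ i ^ d i) := by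
    intro d T
    classical
    induction T using Finset.induction_on with
    | empty => simpa using hone
    | insert i T hi ih =>
      rw [Finset.sum_insert hi, Finset.prod_insert hi]
      exact hmul (hpow i _) ih
  rw [aeval_def, eval₂_eq]
  refine Finset.sum_induction _ (P f.totalDegree) (fun _ _ => hadd) (hzero _) ?_
  intro d hd
  refine hmono (le_totalDegree hd) ?_
  have := hmul (hconst (coeff d f)) (hprod d d.support)
  rwa [zero_add] at this

variable (σ F) in
/-- An algebraically closed field containing all rational functions. -/
abbrev FunctionFieldClosure : Type := AlgebraicClosure (FractionRing (MvPolynomial σ F))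

theorem algebraMap_functionFieldClosure_injective :
    Function.Injective (algebraMap (MvPolynomial σ F) (FunctionFieldClosure σ F)) := by
  rw [IsScalarTower.algebraMap_eq (MvPolynomial σ F) (FractionRing (MvPolynomial σ F))]
  exact (algebraMap (FractionRing (MvPolynomial σ F)) _).injective.comp
    (IsFractionRing.injective _ _)

/-- The image of a variable in the closure of the function field. -/
noncomputable def genericPoint (s : σ) : FunctionFieldClosure σ F :=
  algebraMap (MvPolynomial σ F) _ (X s)

theorem aeval_genericPoint (f : MvPolynomial σ F) :
    aeval (genericPoint (F := F)) f = algebraMap _ (FunctionFieldClosure σ F) f := by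
  have : (aeval (genericPoint (F := F)) : MvPolynomial σ F →ₐ[F] _) =
      IsScalarTower.toAlgHom F (MvPolynomial σ F) (FunctionFieldClosure σ F) := by
    ext i : 1
    simp [genericPoint]
  rw [this]
  rfl

theorem aeval_genericPoint_injective :
    Function.Injective (aeval (genericPoint (F := F)) :
      MvPolynomial σ F →ₐ[F] FunctionFieldClosure σ F) := by
  intro f g h
  rw [aeval_genericPoint, aeval_genericPoint] at h
  exact algebraMap_functionFieldClosure_injective h

variable [DecidableEq σ]

/-- View a polynomial as a univariate polynomial in its `j`-th variable. -/
noncomputable def toUnivariate (j : σ) :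
    MvPolynomial σ F →ₐ[F] Polynomial (MvPolynomial σ F) :=
  aeval fun i => if i = j then Polynomial.X else Polynomial.C (X i)

/-- Substitute zero for all variables outside `S`. -/
noncomputable def restrictVars (S : Finset σ) : MvPolynomial σ F →ₐ[F] MvPolynomial σ F :=
  aeval fun i => if i ∈ S then X i else 0

/-- Eliminate the `j`-th variable from two polynomials by a resultant. -/
noncomputable def eliminate (j : σ) (u w : MvPolynomial σ F) : MvPolynomial σ F :=
  Polynomial.resultant (toUnivariate j u) (toUnivariate j w)
    (toUnivariate j u).natDegree ((toUnivariate j w).natDegree + 1)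

theorem toUnivariate_degree_le (j : σ) (f : MvPolynomial σ F) :
    (toUnivariate j f).natDegree ≤ f.totalDegree ∧
      ∀ k, ((toUnivariate j f).coeff k).totalDegree ≤ f.totalDegree := by
  refine aeval_mem_filtration
    (P := fun d (p : Polynomial (MvPolynomial σ F)) =>
      p.natDegree ≤ d ∧ ∀ k, (p.coeff k).totalDegree ≤ d) ?_ ?_ ?_ ?_ _ ?_ f
  · exact fun hab h => ⟨h.1.trans hab, fun k => (h.2 k).trans hab⟩
  · intro a x y hx hy
    refine ⟨Polynomial.natDegree_add_le_of_degree_le hx.1 hy.1, fun k => ?_⟩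
    rw [Polynomial.coeff_add]
    exact (totalDegree_add _ _).trans (max_le (hx.2 k) (hy.2 k))
  · intro c
    have : algebraMap F (Polynomial (MvPolynomial σ F)) c = Polynomial.C (C c) := rfl
    rw [this]
    refine ⟨by simp, fun k => ?_⟩
    rw [Polynomial.coeff_C]
    split_ifs <;> simp
  · intro a b x y hx hy
    refine ⟨Polynomial.natDegree_mul_le_of_le hx.1 hy.1, fun k => ?_⟩
    rw [Polynomial.coeff_mul]
    refine totalDegree_finsetSum_le fun i _ => ?_
    exact (totalDegree_mul _ _).trans (add_le_add (hx.2 _) (hy.2 _))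
  · intro i
    split_ifs
    · refine ⟨Polynomial.natDegree_X_le, fun k => ?_⟩
      rw [Polynomial.coeff_X]
      split_ifs <;> simp
    · refine ⟨by simp, fun k => ?_⟩
      rw [Polynomial.coeff_C]
      split_ifs <;> simp

theorem totalDegree_eliminate_le (j : σ) {u w : MvPolynomial σ F} {d : ℕ}
    (hu : u.totalDegree ≤ d) (hw : w.totalDegree ≤ d) :
    (eliminate j u w).totalDegree ≤ (2 * d + 1) * d := by
  have hu' := toUnivariate_degree_le j u
  have hw' := toUnivariate_degree_le j w
  set m := (toUnivariate j u).natDegree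
  set n := (toUnivariate j w).natDegree
  have hentry : ∀ a b, (Polynomial.sylvester (toUnivariate j u) (toUnivariate j w) m (n + 1)
      a b).totalDegree ≤ d := by
    intro a b
    induction b using Fin.addCases with
    | left b =>
      simp only [Polynomial.sylvester, Matrix.of_apply, Fin.addCases_left]
      split_ifs
      · exact (hw'.2 _).trans hw
      · simp
    | right b =>
      simp only [Polynomial.sylvester, Matrix.of_apply, Fin.addCases_right]
      split_ifs
      · exact (hu'.2 _).trans hu
      · simp
  unfold eliminate Polynomial.resultant
  rw [Matrix.det_apply]
  refine totalDegree_finsetSum_le fun π _ => ?_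
  have hsign : ∀ p : MvPolynomial σ F,
      (Equiv.Perm.sign π • p).totalDegree = p.totalDegree := by
    intro p
    rcases Int.units_eq_one_or (Equiv.Perm.sign π) with h | h <;> simp [h]
  rw [hsign]
  refine (totalDegree_finsetProd _ _).trans ((Finset.sum_le_card_nsmul _ _ d
    fun a _ => hentry _ _).trans ?_)
  simp only [Finset.card_univ, Fintype.card_fin, smul_eq_mul]
  refine Nat.mul_le_mul_right _ ?_
  have := hu'.1.trans hu
  have := hw'.1.trans hw
  omega

theorem map_toUnivariate {B : Type*} [CommRing B] [Algebra F B] (j : σ)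
    (φ : MvPolynomial σ F →ₐ[F] B) (f : MvPolynomial σ F) :
    (toUnivariate j f).map φ.toRingHom =
      aeval (fun i => if i = j then Polynomial.X else Polynomial.C (φ (X i))) f := by
  have : (Polynomial.mapAlgHom φ).comp (toUnivariate j) =
      aeval (fun i => if i = j then Polynomial.X else Polynomial.C (φ (X i))) := by
    ext i : 1
    simp only [toUnivariate, AlgHom.comp_apply, aeval_X]
    split_ifs <;> simp
  exact DFunLike.congr_fun this f

theorem eval_map_toUnivariate {B : Type*} [CommRing B] [Algebra F B] (j : σ) (ξ : σ → B)
    (η : B) (f : MvPolynomial σ F) :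
    ((toUnivariate j f).map (aeval ξ : MvPolynomial σ F →ₐ[F] B).toRingHom).eval η =
      aeval (Function.update ξ j η) f := by
  have h := map_toUnivariate j (aeval ξ : MvPolynomial σ F →ₐ[F] B) f
  simp only [aeval_X] at h
  have : (((Polynomial.aeval η).restrictScalars F).comp
      (aeval (fun i => if i = j then Polynomial.X else Polynomial.C (ξ i)) :
        MvPolynomial σ F →ₐ[F] Polynomial B)) = aeval (Function.update ξ j η) := by
    ext i : 1
    simp only [AlgHom.comp_apply, aeval_X, Function.update_apply]
    split_ifs <;> simp
  rw [← this]
  simp only [AlgHom.comp_apply, AlgHom.restrictScalars_apply, Polynomial.coe_aeval_eq_eval]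
  rw [← h]

theorem restrictVars_eq_of_subset {S T : Finset σ} (hST : S ⊆ T) {f : MvPolynomial σ F}
    (hf : restrictVars S f = f) : restrictVars T f = f := by
  have : (restrictVars T).comp (restrictVars S) = (restrictVars S : _ →ₐ[F] _) := by
    ext i : 1
    simp only [restrictVars, AlgHom.comp_apply, aeval_X]
    split_ifs with h
    · simp [hST h]
    · simp
  conv_lhs => rw [← hf]
  exact (DFunLike.congr_fun this f).trans hf

theorem aeval_eq_of_restrictVars {B : Type*} [CommRing B] [Algebra F B] {S : Finset σ}
    {f : MvPolynomial σ F} (hf : restrictVars S f = f) {φ ψ : σ → B}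
    (h : ∀ i ∈ S, φ i = ψ i) : aeval φ f = aeval ψ f := by
  have : ((aeval φ).comp (restrictVars S) : _ →ₐ[F] B) = (aeval ψ).comp (restrictVars S) := by
    ext i : 1
    simp only [restrictVars, AlgHom.comp_apply, aeval_X]
    split_ifs with hi
    · simp [h i hi]
    · simp
  rw [← hf]
  exact DFunLike.congr_fun this f

theorem map_restrictVars_toUnivariate {S : Finset σ} {j : σ} {f : MvPolynomial σ F}
    (hf : restrictVars S f = f) :
    (toUnivariate j f).map
        (restrictVars (S.erase j) : MvPolynomial σ F →ₐ[F] MvPolynomial σ F).toRingHom =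
      toUnivariate j f := by
  rw [map_toUnivariate]
  refine aeval_eq_of_restrictVars hf fun i hi => ?_
  split_ifs with hij
  · rfl
  · simp [restrictVars, hij, hi]

theorem restrictVars_eliminate {S : Finset σ} {j : σ} {u w : MvPolynomial σ F}
    (hu : restrictVars S u = u) (hw : restrictVars S w = w) :
    restrictVars (S.erase j) (eliminate j u w) = eliminate j u w := by
  have := Polynomial.resultant_map_map (toUnivariate j u) (toUnivariate j w)
    (toUnivariate j u).natDegree ((toUnivariate j w).natDegree + 1)
    (restrictVars (S.erase j) : MvPolynomial σ F →ₐ[F] MvPolynomial σ F).toRingHom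
  rw [map_restrictVars_toUnivariate hu, map_restrictVars_toUnivariate hw] at this
  exact this.symm

theorem eval_eliminate_eq_zero {j : σ} {u w : MvPolynomial σ F} {x : σ → F}
    (hu : eval x u = 0) (hw : eval x w = 0) : eval x (eliminate j u w) = 0 := by
  obtain ⟨p, q, -, -, h⟩ := Polynomial.exists_mul_add_mul_eq_C_resultant
    (m := (toUnivariate j u).natDegree) (n := (toUnivariate j w).natDegree + 1)
    (toUnivariate j u) (toUnivariate j w) le_rfl (Nat.le_succ _) (Or.inr (Nat.succ_ne_zero _))
  have key : ∀ f : MvPolynomial σ F,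
      ((toUnivariate j f).map (eval x)).eval (x j) = eval x f := by
    intro f
    have := eval_map_toUnivariate j x (x j) f
    rw [Function.update_eq_self] at this
    exact this
  have h' := congrArg (fun P => (Polynomial.map (eval x) P).eval (x j)) h
  simp only [Polynomial.map_add, Polynomial.map_mul, Polynomial.eval_add, Polynomial.eval_mul,
    Polynomial.map_C, Polynomial.eval_C, key, hu, hw, zero_mul, add_zero] at h'
  exact h'.symm

theorem aeval_eliminate_ne_zero {L : Type*} [Field L] [IsAlgClosed L] [Algebra F L] {j : σ}
    {u w : MvPolynomial σ F} {ξ : σ → L}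
    (hdeg : ((toUnivariate j u).map (aeval ξ : MvPolynomial σ F →ₐ[F] L).toRingHom).natDegree =
      (toUnivariate j u).natDegree)
    (hu : (toUnivariate j u).map (aeval ξ : MvPolynomial σ F →ₐ[F] L).toRingHom ≠ 0)
    (hw : ∀ η, aeval (Function.update ξ j η) u = 0 → aeval (Function.update ξ j η) w ≠ 0) :
    aeval ξ (eliminate j u w) ≠ 0 := by
  have h := Polynomial.resultant_map_map (toUnivariate j u) (toUnivariate j w)
    (toUnivariate j u).natDegree ((toUnivariate j w).natDegree + 1)
    (aeval ξ : MvPolynomial σ F →ₐ[F] L).toRingHom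
  have h2 := Polynomial.resultant_eq_prod_eval
    ((toUnivariate j u).map (aeval ξ : MvPolynomial σ F →ₐ[F] L).toRingHom)
    ((toUnivariate j w).map (aeval ξ : MvPolynomial σ F →ₐ[F] L).toRingHom)
    ((toUnivariate j w).natDegree + 1)
    (Polynomial.natDegree_map_le.trans (Nat.le_succ _)) (IsAlgClosed.splits _)
  rw [hdeg, h] at h2
  change (aeval ξ : MvPolynomial σ F →ₐ[F] L).toRingHom (eliminate j u w) ≠ 0
  unfold eliminate
  rw [h2]
  refine mul_ne_zero (pow_ne_zero _ (Polynomial.leadingCoeff_ne_zero.2 hu)) ?_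
  intro h0
  rw [Multiset.prod_eq_zero_iff, Multiset.mem_map] at h0
  obtain ⟨η, hη, h0⟩ := h0
  rw [Polynomial.mem_roots hu, Polynomial.IsRoot.def] at hη
  rw [eval_map_toUnivariate] at hη h0
  exact hw η hη h0

/-- The degree growth of one elimination step. -/
def elimDegree (d : ℕ) : ℕ := (2 * d + 1) * d + d

theorem le_elimDegree_iterate (d k : ℕ) : d ≤ elimDegree^[k] d :=
  Function.id_le_iterate_of_id_le (fun d => Nat.le_add_left d _) k d

theorem exists_elimination [Fintype σ] (S : Finset σ) (u : σ → MvPolynomial σ F) (M : ℕ)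
    (hu0 : ∀ j ∉ S, u j ≠ 0) (huS : ∀ j ∉ S, restrictVars (insert j S) (u j) = u j)
    (huM : ∀ j ∉ S, (u j).totalDegree ≤ M) :
    ∃ Ξ : Finset (σ → FunctionFieldClosure σ F), Ξ.card ≤ (M + 1) ^ Fintype.card σ ∧
      (∀ ξ ∈ Ξ, ∀ s ∈ S, ξ s = genericPoint s) ∧
      ∀ (g : MvPolynomial σ F) (d : ℕ), g.totalDegree ≤ d → M ≤ d →
        (∀ ξ ∈ Ξ, aeval ξ g ≠ 0) →
        ∃ w : MvPolynomial σ F, w ≠ 0 ∧ restrictVars S w = w ∧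
          w.totalDegree ≤ elimDegree^[Sᶜ.card] d ∧
          ∀ x : σ → F, (∀ j ∉ S, eval x (u j) = 0) → eval x g = 0 → eval x w = 0 := by
  classical
  let gen : MvPolynomial σ F →ₐ[F] FunctionFieldClosure σ F := aeval genericPoint
  have hgen : Function.Injective gen.toRingHom := aeval_genericPoint_injective
  let v : σ → Polynomial (FunctionFieldClosure σ F) :=
    fun j => (toUnivariate j (u j)).map gen.toRingHom
  have hvdeg : ∀ j, (v j).natDegree = (toUnivariate j (u j)).natDegree :=
    fun j => Polynomial.natDegree_map_eq_of_injective hgen _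
  have hv0 : ∀ j ∉ S, v j ≠ 0 := by
    intro j hj h
    have h1 := eval_map_toUnivariate j (genericPoint (F := F)) (genericPoint j) (u j)
    rw [Function.update_eq_self] at h1
    change (v j).eval _ = _ at h1
    rw [h, Polynomial.eval_zero] at h1
    exact hu0 j hj (aeval_genericPoint_injective (h1.symm.trans (map_zero _).symm))
  have hvξ : ∀ j ∉ S, ∀ ξ : σ → FunctionFieldClosure σ F, (∀ s ∈ S, ξ s = genericPoint s) →
      (toUnivariate j (u j)).map (aeval ξ : _ →ₐ[F] FunctionFieldClosure σ F).toRingHom = v j := by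
    intro j hj ξ hξ
    rw [map_toUnivariate]
    change _ = (toUnivariate j (u j)).map gen.toRingHom
    rw [map_toUnivariate]
    refine aeval_eq_of_restrictVars (huS j hj) fun i hi => ?_
    split_ifs with hij
    · rfl
    · have := hξ i ((Finset.mem_insert.1 hi).resolve_left hij)
      simp [this, gen]
  let Ξ : Finset (σ → FunctionFieldClosure σ F) :=
    Fintype.piFinset fun s => if s ∈ S then {genericPoint s} else (v s).roots.toFinset
  have hΞS : ∀ ξ ∈ Ξ, ∀ s ∈ S, ξ s = genericPoint s := by
    intro ξ hξ s hs
    have := Fintype.mem_piFinset.1 hξ s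
    simpa [hs] using this
  refine ⟨Ξ, ?_, hΞS, ?_⟩
  · rw [Fintype.card_piFinset, ← Finset.card_univ, ← Finset.prod_const]
    refine Finset.prod_le_prod' fun s _ => ?_
    split_ifs with hs
    · simp
    · refine (Multiset.toFinset_card_le _).trans ((Polynomial.card_roots' _).trans ?_)
      rw [hvdeg]
      exact ((toUnivariate_degree_le s (u s)).1.trans (huM s hs)).trans (Nat.le_succ M)
  · intro g d hg hMd hgΞ
    have main : ∀ T : Finset σ, Disjoint T S →
        ∃ w : MvPolynomial σ F,
          (∀ ξ : σ → FunctionFieldClosure σ F, (∀ s ∈ S, ξ s = genericPoint s) →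
            (∀ j ∉ S, j ∉ T → ξ j ∈ (v j).roots) → aeval ξ w ≠ 0) ∧
          restrictVars Tᶜ w = w ∧ w.totalDegree ≤ elimDegree^[T.card] d ∧
          ∀ x : σ → F, (∀ j ∉ S, eval x (u j) = 0) → eval x g = 0 → eval x w = 0 := by
      intro T
      induction T using Finset.induction_on with
      | empty =>
        intro _
        refine ⟨g, fun ξ hξS hξ => hgΞ ξ (Fintype.mem_piFinset.2 fun s => ?_), ?_, hg,
          fun _ _ h => h⟩
        · split_ifs with hs
          · exact Finset.mem_singleton.2 (hξS s hs)
          · exact Multiset.mem_toFinset.2 (hξ s hs (Finset.notMem_empty s))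
        · simp [restrictVars]
      | insert j T hjT ih =>
        intro hdisj
        rw [Finset.disjoint_insert_left] at hdisj
        obtain ⟨hjS, hTS⟩ := hdisj
        obtain ⟨w, hwΞ, hwT, hwd, hwx⟩ := ih hTS
        refine ⟨eliminate j (u j) w, ?_, ?_, ?_, ?_⟩
        · intro ξ hξS hξ
          refine aeval_eliminate_ne_zero ?_ ?_ ?_
          · rw [hvξ j hjS ξ hξS, hvdeg]
          · rw [hvξ j hjS ξ hξS]
            exact hv0 j hjS
          · intro η hη
            refine hwΞ _ (fun s hs => ?_) fun i hiS hiT => ?_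
            · rw [Function.update_of_ne (by rintro rfl; exact hjS hs)]
              exact hξS s hs
            · by_cases hij : i = j
              · subst hij
                rw [Function.update_self, Polynomial.mem_roots (hv0 i hjS),
                  Polynomial.IsRoot.def, ← hvξ i hjS ξ hξS, eval_map_toUnivariate]
                exact hη
              · rw [Function.update_of_ne hij]
                exact hξ i hiS (by simp [hij, hiT])
        · rw [show (insert j T)ᶜ = Tᶜ.erase j by ext; simp]
          refine restrictVars_eliminate (restrictVars_eq_of_subset ?_ (huS j hjS)) hwT
          intro i hi
          rcases Finset.mem_insert.1 hi with rfl | hi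
          · simpa using hjT
          · exact Finset.mem_compl.2 fun hiT => Finset.disjoint_left.1 hTS hiT hi
        · rw [Finset.card_insert_of_notMem hjT, Function.iterate_succ_apply']
          exact (totalDegree_eliminate_le j (((huM j hjS).trans hMd).trans
            (le_elimDegree_iterate d _)) hwd).trans (Nat.le_add_right _ _)
        · exact fun x hx hgx => eval_eliminate_eq_zero (hx j hjS) (hwx x hx hgx)
    obtain ⟨w, hwΞ, hwS, hwd, hwx⟩ := main Sᶜ disjoint_compl_left
    rw [compl_compl] at hwS
    refine ⟨w, ?_, hwS, hwd, hwx⟩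
    rintro rfl
    exact hwΞ genericPoint (fun _ _ => rfl)
      (fun j hj hj' => absurd (Finset.mem_compl.2 hj) hj') (map_zero _)

end Elimination

section Perturbation

variable {σ F : Type} [Fintype σ] [Field F]

/-- The sum of univariate polynomials of degree at most `D` with prescribed coefficients. -/
noncomputable def diagonalPoly {D : ℕ} (a : σ × Fin (D + 1) → F) : MvPolynomial σ F :=
  ∑ i, C (a i) * X i.1 ^ (i.2 : ℕ)

theorem diagonalPoly_add {D : ℕ} (a a' : σ × Fin (D + 1) → F) :
    diagonalPoly (a + a') = diagonalPoly a + diagonalPoly a' := by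
  simp [diagonalPoly, add_mul, Finset.sum_add_distrib]

theorem totalDegree_diagonalPoly_le {D : ℕ} (a : σ × Fin (D + 1) → F) :
    (diagonalPoly a).totalDegree ≤ D := by
  refine totalDegree_finsetSum_le fun i _ => (totalDegree_mul _ _).trans ?_
  rw [totalDegree_C, totalDegree_X_pow, zero_add]
  exact Nat.lt_succ_iff.1 i.2.2

variable [DecidableEq σ]

/-- Coefficients supported on the powers of a single variable. -/
def axisCoeff {D : ℕ} (s : σ) (c : Fin (D + 1) → F) : σ × Fin (D + 1) → F :=
  fun i => if i.1 = s then c i.2 else 0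

theorem aeval_diagonalPoly_axisCoeff {D : ℕ} (s : σ) (c : Fin (D + 1) → F) {B : Type*}
    [CommRing B] [Algebra F B] (ξ : σ → B) :
    aeval ξ (diagonalPoly (axisCoeff s c)) = ∑ k, algebraMap F B (c k) * ξ s ^ (k : ℕ) := by
  simp only [diagonalPoly, axisCoeff, Fintype.sum_prod_type, map_sum, map_mul, map_pow, aeval_X,
    algHom_C]
  rw [Finset.sum_eq_single s]
  · simp
  · intro t _ hts
    simp [hts]
  · simp

theorem axisCoeff_eq_zero {D : ℕ} {s : σ} {c : Fin (D + 1) → F}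
    {ξ : σ → FunctionFieldClosure σ F} (hξ : ξ s = genericPoint s)
    (h : aeval ξ (diagonalPoly (axisCoeff s c)) = 0) : c = 0 := by
  have h2 : aeval genericPoint (diagonalPoly (axisCoeff s c)) =
      (0 : FunctionFieldClosure σ F) := by
    rw [aeval_diagonalPoly_axisCoeff] at h ⊢
    rwa [hξ] at h
  have h3 : diagonalPoly (axisCoeff s c) = 0 :=
    aeval_genericPoint_injective (h2.trans (map_zero _).symm)
  have h4 := congrArg (aeval fun _ => (Polynomial.X : Polynomial F)) h3
  rw [aeval_diagonalPoly_axisCoeff, map_zero] at h4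
  funext k
  have h5 := congrArg (fun P => Polynomial.coeff P (k : ℕ)) h4
  simpa [Polynomial.finsetSum_coeff, ← Polynomial.C_eq_algebraMap, Polynomial.coeff_X_pow,
    Fin.val_inj] using h5

theorem card_vanishing_mul_le [Fintype F] [DecidableEq F] {D : ℕ} {s : σ}
    {ξ : σ → FunctionFieldClosure σ F} (hξ : ξ s = genericPoint s) (h : MvPolynomial σ F) :
    Nat.card {a : σ × Fin (D + 1) → F // aeval ξ (h + diagonalPoly a) = 0} *
      Fintype.card F ^ (D + 1) ≤ Nat.card (σ × Fin (D + 1) → F) := by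
  have hF : Fintype.card F ^ (D + 1) = Nat.card (Fin (D + 1) → F) := by simp
  rw [hF, ← Nat.card_prod]
  refine Nat.card_le_card_of_injective
    (fun p : {a : σ × Fin (D + 1) → F // aeval ξ (h + diagonalPoly a) = 0} ×
      (Fin (D + 1) → F) => p.1.1 + axisCoeff s p.2) ?_
  rintro ⟨⟨a, ha⟩, c⟩ ⟨⟨a', ha'⟩, c'⟩ heq
  simp only at heq
  have hsub : axisCoeff s (c - c') = axisCoeff s c - axisCoeff s c' := by
    funext i
    simp only [axisCoeff, Pi.sub_apply]
    split_ifs <;> simp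
  have ha2 : a' = a + axisCoeff s (c - c') := by
    rw [hsub, ← add_sub_assoc, heq, add_sub_cancel_right]
  have hc : c - c' = 0 := by
    refine axisCoeff_eq_zero hξ ?_
    rw [ha2, diagonalPoly_add, ← add_assoc, map_add, ha, zero_add] at ha'
    exact ha'
  have hcc : c = c' := sub_eq_zero.1 hc
  subst hcc
  have : a = a' := add_right_cancel heq
  subst this
  rfl

/-- Every set of the appropriate number of variables supports a nonzero polynomial of degree at
most `M` vanishing on the common zeros of `g`. -/
def HasEliminants (M : ℕ) {i : ℕ} (g : Fin i → MvPolynomial σ F) : Prop :=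
  ∀ S : Finset σ, S.card + i = Fintype.card σ + 1 →
    ∃ u : MvPolynomial σ F, u ≠ 0 ∧ restrictVars S u = u ∧ u.totalDegree ≤ M ∧
      ∀ x : σ → F, (∀ a, eval x (g a) = 0) → eval x u = 0

theorem card_extension_le [Fintype F] [DecidableEq F] {D d M i : ℕ} (hi : i + 1 ≤ Fintype.card σ)
    {g : Fin i → MvPolynomial σ F} (hg : HasEliminants M g) {h : MvPolynomial σ F}
    (hh : h.totalDegree ≤ d) (hD : D ≤ d) (hM : M ≤ d) :
    Nat.card {a : σ × Fin (D + 1) → F //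
        ¬ HasEliminants (elimDegree^[i] d) (Fin.cons (h + diagonalPoly a) g : Fin (i + 1) → _)} *
      Fintype.card F ^ (D + 1) ≤
        2 ^ Fintype.card σ * (M + 1) ^ Fintype.card σ * Nat.card (σ × Fin (D + 1) → F) := by
  classical
  have hex : ∀ S : Finset σ, S.card + (i + 1) = Fintype.card σ + 1 →
      ∃ Ξ : Finset (σ → FunctionFieldClosure σ F), Ξ.card ≤ (M + 1) ^ Fintype.card σ ∧
      (∀ ξ ∈ Ξ, ∀ s ∈ S, ξ s = genericPoint s) ∧
      ∀ a : σ × Fin (D + 1) → F, (∀ ξ ∈ Ξ, aeval ξ (h + diagonalPoly a) ≠ 0) →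
        ∃ w : MvPolynomial σ F, w ≠ 0 ∧ restrictVars S w = w ∧
          w.totalDegree ≤ elimDegree^[i] d ∧
          ∀ x : σ → F, (∀ b, eval x ((Fin.cons (h + diagonalPoly a) g :
            Fin (i + 1) → MvPolynomial σ F) b) = 0) → eval x w = 0 := by
    intro S hS
    have hu : ∀ j, ∃ u : MvPolynomial σ F, j ∉ S → (u ≠ 0 ∧ restrictVars (insert j S) u = u ∧
        u.totalDegree ≤ M ∧ ∀ x : σ → F, (∀ a, eval x (g a) = 0) → eval x u = 0) := by
      intro j
      by_cases hj : j ∈ S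
      · exact ⟨0, fun h => absurd hj h⟩
      · obtain ⟨u, hu⟩ := hg (insert j S) (by rw [Finset.card_insert_of_notMem hj]; omega)
        exact ⟨u, fun _ => hu⟩
    choose u hu using hu
    obtain ⟨Ξ, hΞ1, hΞ2, hΞ3⟩ := exists_elimination S u M (fun j hj => (hu j hj).1)
      (fun j hj => (hu j hj).2.1) (fun j hj => (hu j hj).2.2.1)
    refine ⟨Ξ, hΞ1, hΞ2, fun a ha => ?_⟩
    obtain ⟨w, hw0, hwS, hwd, hwx⟩ := hΞ3 (h + diagonalPoly a) d
      ((totalDegree_add _ _).trans (max_le hh ((totalDegree_diagonalPoly_le a).trans hD))) hM ha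
    have hSc : Sᶜ.card = i := by
      rw [Finset.card_compl]
      omega
    rw [hSc] at hwd
    refine ⟨w, hw0, hwS, hwd, fun x hx => hwx x (fun j hj => ?_) (hx 0)⟩
    exact (hu j hj).2.2.2 x fun a => hx a.succ
  choose Ξ hΞ1 hΞ2 hΞ3 using hex
  let 𝒮 : Finset {S : Finset σ // S.card + (i + 1) = Fintype.card σ + 1} := Finset.univ
  let V : (σ → FunctionFieldClosure σ F) → Finset (σ × Fin (D + 1) → F) :=
    fun ξ => Finset.univ.filter fun a => aeval ξ (h + diagonalPoly a) = 0
  have hsub : (Finset.univ.filter fun a : σ × Fin (D + 1) → F =>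
      ¬ HasEliminants (elimDegree^[i] d) (Fin.cons (h + diagonalPoly a) g : Fin (i + 1) → _)) ⊆
      𝒮.biUnion fun S => (Ξ S.1 S.2).biUnion V := by
    intro a ha
    rw [Finset.mem_filter] at ha
    by_contra hcon
    refine ha.2 fun S hS => hΞ3 S hS a fun ξ hξ h0 => hcon ?_
    exact Finset.mem_biUnion.2 ⟨⟨S, hS⟩, Finset.mem_univ _, Finset.mem_biUnion.2
      ⟨ξ, hξ, Finset.mem_filter.2 ⟨Finset.mem_univ _, h0⟩⟩⟩
  have hcard : 𝒮.card ≤ 2 ^ Fintype.card σ := by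
    rw [Finset.card_univ, ← Fintype.card_finset]
    exact Fintype.card_subtype_le _
  rw [Nat.card_eq_fintype_card, Fintype.card_subtype]
  refine (Nat.mul_le_mul_right _ ((Finset.card_le_card hsub).trans Finset.card_biUnion_le)).trans ?_
  rw [Finset.sum_mul]
  have hterm : ∀ S ∈ 𝒮, ((Ξ S.1 S.2).biUnion V).card * Fintype.card F ^ (D + 1) ≤
      (M + 1) ^ Fintype.card σ * Nat.card (σ × Fin (D + 1) → F) := by
    intro S _
    refine (Nat.mul_le_mul_right _ Finset.card_biUnion_le).trans ?_
    rw [Finset.sum_mul]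
    refine (Finset.sum_le_card_nsmul _ _ (Nat.card (σ × Fin (D + 1) → F)) fun ξ hξ => ?_).trans ?_
    · obtain ⟨s, hs⟩ : S.1.Nonempty := by
        rw [← Finset.card_pos]
        have := S.2
        omega
      have := card_vanishing_mul_le (D := D) (hΞ2 S.1 S.2 ξ hξ s hs) h
      rwa [Nat.card_eq_fintype_card, Fintype.card_subtype] at this
    · rw [smul_eq_mul]
      exact Nat.mul_le_mul_right _ (hΞ1 S.1 S.2)
  refine (Finset.sum_le_card_nsmul _ _ _ hterm).trans ?_
  rw [smul_eq_mul, ← mul_assoc]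
  gcongr

theorem exists_card_not_hasEliminants_le (σ : Type) [Fintype σ] [DecidableEq σ] (D d i : ℕ)
    (hi : i ≤ Fintype.card σ) :
    ∃ M K : ℕ, ∀ (F : Type) [Field F] [Fintype F] [DecidableEq F]
      (h : Fin i → MvPolynomial σ F), (∀ a, (h a).totalDegree ≤ d) →
      Nat.card {w : Fin i → (σ × Fin (D + 1) → F) //
          ¬ HasEliminants M fun a => h a + diagonalPoly (w a)} * Fintype.card F ^ (D + 1) ≤
        K * Nat.card (σ × Fin (D + 1) → F) ^ i := by
  induction i with
  | zero =>
    refine ⟨0, 0, fun F _ _ _ h _ => ?_⟩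
    rw [zero_mul, Nat.le_zero, mul_eq_zero]
    left
    have : IsEmpty {w : Fin 0 → (σ × Fin (D + 1) → F) //
        ¬ HasEliminants 0 fun a => h a + diagonalPoly (w a)} := by
      refine ⟨fun w => w.2 fun S hS => ?_⟩
      have := Finset.card_le_univ S
      omega
    exact Nat.card_of_isEmpty
  | succ i ih =>
    obtain ⟨M, K, hMK⟩ := ih (by omega)
    refine ⟨elimDegree^[i] (M + D + d), K + 2 ^ Fintype.card σ * (M + 1) ^ Fintype.card σ,
      fun F _ _ _ h hd => ?_⟩
    classical
    have hbad := hMK F (fun a => h a.succ) fun a => hd a.succ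
    let U := σ × Fin (D + 1) → F
    let B : (Fin i → U) → Prop := fun w =>
      ¬ HasEliminants M fun a => h a.succ + diagonalPoly (w a)
    let E : (Fin i → U) → U → Prop := fun w a =>
      ¬ HasEliminants (elimDegree^[i] (M + D + d))
        (Fin.cons (h 0 + diagonalPoly a) fun a => h a.succ + diagonalPoly (w a) : Fin (i + 1) → _)
    have hE : ∀ w, ¬ B w → Nat.card {a // E w a} * Fintype.card F ^ (D + 1) ≤
        2 ^ Fintype.card σ * (M + 1) ^ Fintype.card σ * Nat.card U := fun w hw =>
      card_extension_le (by omega) (not_not.1 hw) ((hd 0).trans (by omega)) (by omega) (by omega)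
    have hcount : Nat.card {w : Fin (i + 1) → U // ¬ HasEliminants (elimDegree^[i] (M + D + d))
        fun a => h a + diagonalPoly (w a)} = ∑ w : Fin i → U, Nat.card {a // E w a} := by
      rw [← Nat.card_sigma]
      refine Nat.card_congr ((Equiv.subtypeEquiv (q := fun p : (Fin i → U) × U => E p.1 p.2)
        ((Fin.consEquiv fun _ => U).symm.trans (Equiv.prodComm _ _)) fun w => ?_).trans
        (Equiv.subtypeProdEquivSigmaSubtype fun w a => E w a))
      refine not_congr (iff_of_eq (congrArg _ ?_))
      funext a
      refine Fin.cases ?_ (fun a => ?_) a <;> rfl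
    change Nat.card {w : Fin (i + 1) → U // _} * _ ≤ _ * Nat.card U ^ (i + 1)
    change Nat.card {w : Fin i → U // B w} * _ ≤ _ * Nat.card U ^ i at hbad
    rw [hcount, Finset.sum_mul]
    have hsplit : ∀ w, Nat.card {a // E w a} * Fintype.card F ^ (D + 1) ≤
        (if B w then Nat.card U * Fintype.card F ^ (D + 1) else 0) +
          2 ^ Fintype.card σ * (M + 1) ^ Fintype.card σ * Nat.card U := by
      intro w
      split_ifs with hw
      · refine le_add_right (Nat.mul_le_mul_right _ ?_)
        exact Nat.card_le_card_of_injective _ Subtype.val_injective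
      · rw [zero_add]
        exact hE w hw
    refine (Finset.sum_le_sum fun w _ => hsplit w).trans ?_
    have hfun : Fintype.card (Fin i → U) = Nat.card U ^ i := by
      rw [Fintype.card_fun, Fintype.card_fin, Nat.card_eq_fintype_card]
    have hBcard : (Finset.univ.filter B).card = Nat.card {w // B w} := by
      rw [Nat.card_eq_fintype_card, Fintype.card_subtype]
    rw [Finset.sum_add_distrib, ← Finset.sum_filter, Finset.sum_const, Finset.sum_const,
      hBcard, Finset.card_univ, hfun, smul_eq_mul, smul_eq_mul, add_mul]
    refine add_le_add ?_ (le_of_eq (by ring))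
    calc Nat.card {w // B w} * (Nat.card U * Fintype.card F ^ (D + 1))
        = Nat.card {w // B w} * Fintype.card F ^ (D + 1) * Nat.card U := by ring
      _ ≤ K * Nat.card U ^ i * Nat.card U := Nat.mul_le_mul_right _ hbad
      _ = K * Nat.card U ^ (i + 1) := by ring

theorem card_zeros_le_of_hasEliminants [Fintype F] {M i : ℕ} (hi : i = Fintype.card σ)
    {g : Fin i → MvPolynomial σ F} (hg : HasEliminants M g) :
    Nat.card {x : σ → F // ∀ a, eval x (g a) = 0} ≤ (M + 1) ^ Fintype.card σ := by
  classical
  have hex : ∀ j : σ, ∃ u : MvPolynomial σ F, u ≠ 0 ∧ restrictVars {j} u = u ∧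
      u.totalDegree ≤ M ∧ ∀ x : σ → F, (∀ a, eval x (g a) = 0) → eval x u = 0 :=
    fun j => hg {j} (by rw [Finset.card_singleton]; omega)
  choose u hu0 huj huM hux using hex
  let v : σ → Polynomial F := fun j => aeval (fun _ => Polynomial.X) (u j)
  have heval : ∀ j (B : Type) [CommRing B] [Algebra F B] (x : σ → B),
      Polynomial.aeval (x j) (v j) = aeval x (u j) := by
    intro j B _ _ x
    have : ((Polynomial.aeval (x j)).comp (aeval fun _ : σ => Polynomial.X)) =
        (aeval fun _ => x j : MvPolynomial σ F →ₐ[F] B) := by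
      ext i : 1
      simp
    refine (DFunLike.congr_fun this (u j)).trans ?_
    exact aeval_eq_of_restrictVars (huj j) (by simp)
  have hv0 : ∀ j, v j ≠ 0 := by
    intro j h
    have := heval j _ (X : σ → MvPolynomial σ F)
    rw [h, map_zero, aeval_X_left_apply] at this
    exact hu0 j this.symm
  have hvM : ∀ j, (v j).natDegree ≤ M := by
    intro j
    refine (aeval_mem_filtration (P := fun d (p : Polynomial F) => p.natDegree ≤ d)
      (fun hab h => h.trans hab) (fun hx hy => Polynomial.natDegree_add_le_of_degree_le hx hy)
      (fun c => ?_) (fun hx hy => Polynomial.natDegree_mul_le_of_le hx hy) _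
      (fun _ => Polynomial.natDegree_X_le) (u j)).trans (huM j)
    exact (Polynomial.natDegree_C c).le
  let Z : Finset (σ → F) := Fintype.piFinset fun j => (v j).roots.toFinset
  have hZ : Z.card ≤ (M + 1) ^ Fintype.card σ := by
    rw [Fintype.card_piFinset, ← Finset.card_univ, ← Finset.prod_const]
    refine Finset.prod_le_prod' fun j _ => ?_
    exact (Multiset.toFinset_card_le _).trans
      ((Polynomial.card_roots' _).trans ((hvM j).trans (Nat.le_succ M)))
  refine le_trans ?_ hZ
  rw [Nat.card_eq_fintype_card, Fintype.card_subtype]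
  refine Finset.card_le_card fun x hx => Fintype.mem_piFinset.2 fun j => ?_
  rw [Multiset.mem_toFinset, Polynomial.mem_roots (hv0 j), Polynomial.IsRoot.def,
    ← Polynomial.coe_aeval_eq_eval, heval]
  exact hux j x (Finset.mem_filter.1 hx).2

end Perturbation

section Counting

theorem card_mul_le_of_translates {Ω W : Type*} [AddGroup Ω] [Finite Ω] [Finite W] [Nonempty W]
    (T : W → Ω) (P : Ω → Prop) {c k : ℕ}
    (h : ∀ f, Nat.card {w // P (f + T w)} * c ≤ k * Nat.card W) :
    Nat.card {f // P f} * c ≤ k * Nat.card Ω := by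
  have := Fintype.ofFinite Ω
  have := Fintype.ofFinite W
  have hdouble : ∑ f, Nat.card {w // P (f + T w)} = Nat.card W * Nat.card {f // P f} := by
    rw [← Nat.card_sigma, ← Nat.card_prod]
    refine Nat.card_congr
      { toFun := fun p => (p.2.1, ⟨p.1 + T p.2.1, p.2.2⟩)
        invFun := fun p => ⟨p.2.1 - T p.1, ⟨p.1, by simpa using p.2.2⟩⟩
        left_inv := ?_
        right_inv := ?_ }
    · rintro ⟨f, w, hw⟩
      exact Sigma.subtype_ext (add_sub_cancel_right f (T w)) rfl
    · rintro ⟨w, f, hf⟩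
      simp
  have hsum : (∑ f, Nat.card {w // P (f + T w)}) * c ≤ Nat.card Ω * (k * Nat.card W) := by
    rw [Finset.sum_mul]
    refine (Finset.sum_le_card_nsmul _ _ _ fun f _ => h f).trans ?_
    rw [Finset.card_univ, smul_eq_mul, Nat.card_eq_fintype_card (α := Ω)]
  rw [hdouble] at hsum
  refine Nat.le_of_mul_le_mul_left ?_ (Nat.card_pos (α := W))
  calc Nat.card W * (Nat.card {f // P f} * c) = Nat.card W * Nat.card {f // P f} * c := by ring
    _ ≤ _ := hsum
    _ = _ := by ring

theorem card_le_card_ker_mul {Ω A : Type*} [AddGroup Ω] [AddGroup A] [Finite Ω] [Finite A]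
    (φ : Ω →+ A) : Nat.card Ω ≤ Nat.card {f // φ f = 0} * Nat.card A := by
  rw [← Nat.card_prod]
  have hinv : ∀ f, φ (Function.invFun φ (φ f)) = φ f := fun f => Function.invFun_eq ⟨f, rfl⟩
  refine Nat.card_le_card_of_injective
    (fun f => (⟨f - Function.invFun φ (φ f), by rw [map_sub, hinv, sub_self]⟩, φ f)) ?_
  intro f g h
  simp only [Prod.mk.injEq, Subtype.mk.injEq] at h
  rw [h.2] at h
  exact sub_left_injective h.1

theorem card_mul_card_le_sum_card_ker {ι Ω A : Type*} [Finite ι] [AddGroup Ω] [AddGroup A]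
    [Fintype Ω] [Finite A] (φ : ι → Ω →+ A) :
    Nat.card ι * Nat.card Ω ≤ (∑ f, Nat.card {x // φ x f = 0}) * Nat.card A := by
  have := Fintype.ofFinite ι
  have hswap : ∑ f, Nat.card {x // φ x f = 0} = ∑ x, Nat.card {f // φ x f = 0} := by
    classical
    simp only [Nat.card_eq_fintype_card, Fintype.card_subtype]
    exact Finset.sum_card_bipartiteAbove_eq_sum_card_bipartiteBelow fun f x => φ x f = 0
  rw [hswap, Finset.sum_mul, Nat.card_eq_fintype_card (α := ι), ← Finset.card_univ,
    ← smul_eq_mul]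
  exact Finset.card_nsmul_le_sum _ _ _ fun x _ => card_le_card_ker_mul (φ x)

/-- If the average of `X` over all of `Ω` is at least `N / k`, then some element outside a
sufficiently sparse set `B` has at least half of that value. -/
theorem exists_large_of_sparse {Ω : Type*} [Finite Ω] [Nonempty Ω] (X : Ω → ℕ) (B : Ω → Prop)
    {N k : ℕ} (hk : 0 < k) (hX : ∀ f, X f ≤ N)
    (hsum : ∀ [Fintype Ω], N * Nat.card Ω ≤ (∑ f, X f) * k)
    (hB : 2 * Nat.card {f // B f} * k ≤ Nat.card Ω) :
    ∃ f, ¬ B f ∧ N ≤ 2 * X f * k := by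
  classical
  have := Fintype.ofFinite Ω
  by_contra! hcon
  have hBcard : (Finset.univ.filter B).card = Nat.card {f // B f} := by
    rw [Nat.card_eq_fintype_card, Fintype.card_subtype]
  have hsplit := Finset.card_filter_add_card_filter_not (s := (Finset.univ : Finset Ω)) B
  rw [hBcard, Finset.card_univ, ← Nat.card_eq_fintype_card] at hsplit
  have hpos := Nat.card_pos (α := Ω)
  have hle : Nat.card {f // B f} ≤ Nat.card {f // B f} * k := Nat.le_mul_of_pos_right _ hk
  have hne : (Finset.univ.filter fun f => ¬ B f).Nonempty := by
    rw [← Finset.card_pos]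
    have : 2 * Nat.card {f // B f} * k = 2 * (Nat.card {f // B f} * k) := by ring
    omega
  have hgood : ∑ f with ¬ B f, 2 * X f * k < ∑ f with ¬ B f, N :=
    Finset.sum_lt_sum_of_nonempty hne fun f hf => hcon f (Finset.mem_filter.1 hf).2
  have hbad : ∑ f with B f, 2 * X f * k ≤ N * Nat.card Ω := by
    refine (Finset.sum_le_card_nsmul _ _ (2 * N * k) fun f _ => ?_).trans ?_
    · gcongr
      exact hX f
    · rw [hBcard, smul_eq_mul]
      calc Nat.card {f // B f} * (2 * N * k) = N * (2 * Nat.card {f // B f} * k) := by ring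
        _ ≤ _ := Nat.mul_le_mul_left _ hB
  have hgood' : ∑ f with ¬ B f, N ≤ N * Nat.card Ω := by
    rw [Finset.sum_const, smul_eq_mul, mul_comm]
    refine Nat.mul_le_mul_left _ ?_
    omega
  have htotal := Finset.sum_filter_add_sum_filter_not (Finset.univ : Finset Ω) B
    fun f => 2 * X f * k
  have h2 : ∑ f, 2 * X f * k = 2 * ((∑ f, X f) * k) := by
    rw [Finset.sum_mul, Finset.mul_sum]
    exact Finset.sum_congr rfl fun f _ => by ring
  have := hsum
  omega

end Counting

section Specialization

variable {κ : Type} [DecidableEq κ] {σ F : Type} [Field F]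

/-- The homogenizing coordinate `1` followed by the coordinates `x`. -/
def affineCoords {B : Type*} [One B] (x : σ → B) (o : Option σ) : B := o.elim 1 x

/-- Specialize all blocks of variables except the `j`-th one, and dehomogenize the latter. -/
noncomputable def specialize (j : κ) (y : κ × Option σ → F) :
    MvPolynomial (κ × Option σ) F →ₐ[F] MvPolynomial σ F :=
  aeval fun i => if i.1 = j then affineCoords X i.2 else C (y i)

theorem totalDegree_specialize_le (j : κ) (y : κ × Option σ → F)
    (f : MvPolynomial (κ × Option σ) F) : (specialize j y f).totalDegree ≤ f.totalDegree := by
  refine aeval_mem_filtration (P := fun d (p : MvPolynomial σ F) => p.totalDegree ≤ d)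
    (fun hab h => h.trans hab) (fun hx hy => (totalDegree_add _ _).trans (max_le hx hy))
    (fun c => (totalDegree_C c).le)
    (fun hx hy => (totalDegree_mul _ _).trans (add_le_add hx hy)) _ ?_ f
  rintro ⟨l, o⟩
  split_ifs
  · cases o <;> simp [affineCoords]
  · simp

theorem eval_specialize (j : κ) (y : κ × Option σ → F) (x : σ → F)
    (f : MvPolynomial (κ × Option σ) F) :
    eval x (specialize j y f) = eval (fun i => if i.1 = j then affineCoords x i.2 else y i) f := by
  have : (aeval x).comp (specialize j y) =
      (aeval fun i => if i.1 = j then affineCoords x i.2 else y i :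
        MvPolynomial (κ × Option σ) F →ₐ[F] F) := by
    ext ⟨l, o⟩ : 1
    simp only [specialize, AlgHom.comp_apply, aeval_X]
    split_ifs
    · cases o <;> simp [affineCoords]
    · simp
  exact DFunLike.congr_fun this f

theorem specialize_rename (j : κ) (y : κ × Option σ → F) (f : MvPolynomial σ F) :
    specialize j y (rename (fun s => (j, some s)) f) = f := by
  rw [specialize, aeval_rename]
  have : ((fun i : κ × Option σ => if i.1 = j then affineCoords X i.2 else C (y i)) ∘
      fun s => (j, some s)) = (X : σ → MvPolynomial σ F) := by
    funext s
    simp [affineCoords]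
  rw [this, aeval_X_left_apply]

/-- The points `y a` are pairwise distinct outside the `j`-th block of coordinates. -/
def SeparatedOff {k : ℕ} (j : κ) (y : Fin k → κ × Option σ → F) : Prop :=
  ∀ a a', a ≠ a' → ∃ i : κ × Option σ, i.1 ≠ j ∧ y a i ≠ y a' i

theorem exists_interpolation {k : ℕ} {j : κ} {y : Fin k → κ × Option σ → F}
    (hy : SeparatedOff j y) :
    ∃ p : Fin k → MvPolynomial (κ × Option σ) F, (∀ a, (p a).totalDegree ≤ k) ∧
      ∀ a a', specialize j (y a') (p a) = if a' = a then 1 else 0 := by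
  have hex : ∀ a a', ∃ p : MvPolynomial (κ × Option σ) F, p.totalDegree ≤ 1 ∧
      specialize j (y a) p = 1 ∧ (a' ≠ a → specialize j (y a') p = 0) := by
    intro a a'
    by_cases h : a' = a
    · exact ⟨1, by simp, by simp, fun h' => absurd h h'⟩
    · obtain ⟨i, hij, hi⟩ := hy a a' (Ne.symm h)
      refine ⟨C (y a i - y a' i)⁻¹ * (X i - C (y a' i)), ?_, ?_, fun _ => ?_⟩
      · refine (totalDegree_mul _ _).trans ?_
        rw [totalDegree_C, zero_add]
        exact (totalDegree_sub _ _).trans (by simp)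
      · simp only [specialize, map_mul, map_sub, aeval_X, algHom_C, if_neg hij,
          algebraMap_eq]
        rw [← C_sub, ← C_mul, inv_mul_cancel₀ (sub_ne_zero.2 hi), C_1]
      · simp [specialize, if_neg hij, algebraMap_eq]
  choose q hq1 hq2 hq3 using hex
  refine ⟨fun a => ∏ a', q a a', fun a => ?_, fun a a' => ?_⟩
  · refine (totalDegree_finsetProd _ _).trans
      ((Finset.sum_le_card_nsmul _ _ 1 fun a' _ => hq1 a a').trans ?_)
    simp
  · rw [map_prod]
    split_ifs with h
    · subst h
      exact Finset.prod_eq_one fun b _ => hq2 _ _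
    · exact Finset.prod_eq_zero (Finset.mem_univ a') (hq3 a a' h)

variable [Fintype κ] [Fintype σ] [DecidableEq σ] [Fintype F]

instance (d : ℕ) : Finite (restrictTotalDegree (κ × Option σ) F d) :=
  Module.finite_of_finite F

theorem card_specialize_bad_le [DecidableEq F] {D M K k : ℕ}
    (hMK : ∀ h : Fin k → MvPolynomial σ F, (∀ a, (h a).totalDegree ≤ k + D) →
      Nat.card {w : Fin k → (σ × Fin (D + 1) → F) //
          ¬ HasEliminants M fun a => h a + diagonalPoly (w a)} * Fintype.card F ^ (D + 1) ≤
        K * Nat.card (σ × Fin (D + 1) → F) ^ k)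
    {j : κ} {y : Fin k → κ × Option σ → F} (hy : SeparatedOff j y) :
    Nat.card {f : restrictTotalDegree (κ × Option σ) F (k + D) //
        ¬ HasEliminants M fun a => specialize j (y a) f.1} * Fintype.card F ^ (D + 1) ≤
      K * Nat.card (restrictTotalDegree (κ × Option σ) F (k + D)) := by
  obtain ⟨p, hp1, hp2⟩ := exists_interpolation hy
  let T : (Fin k → (σ × Fin (D + 1) → F)) → restrictTotalDegree (κ × Option σ) F (k + D) :=
    fun w => ⟨∑ a, p a * rename (fun s => (j, some s)) (diagonalPoly (w a)), by
      rw [mem_restrictTotalDegree]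
      refine totalDegree_finsetSum_le fun a _ => (totalDegree_mul _ _).trans
        (add_le_add (hp1 a) ((totalDegree_rename_le _ _).trans (totalDegree_diagonalPoly_le _)))⟩
  refine card_mul_le_of_translates T _ fun f => ?_
  have hT : ∀ w a, specialize j (y a) (f + T w).1 =
      specialize j (y a) f.1 + diagonalPoly (w a) := by
    intro w a
    rw [Submodule.coe_add, map_add, map_sum]
    congr 1
    rw [Finset.sum_eq_single a]
    · rw [map_mul, hp2, if_pos rfl, one_mul, specialize_rename]
    · intro a' _ ha'
      rw [map_mul, hp2, if_neg (Ne.symm ha'), zero_mul]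
    · simp
  simp only [hT]
  have := hMK (fun a => specialize j (y a) f.1) fun a =>
    (totalDegree_specialize_le _ _ _).trans ((mem_restrictTotalDegree _ _ _).1 f.2)
  rwa [Nat.card_fun (α := Fin k), Nat.card_fin]

/-- The polynomial has a specialization to a separated system without eliminants. -/
def IsDegenerate (M k : ℕ) (f : MvPolynomial (κ × Option σ) F) : Prop :=
  ∃ (j : κ) (y : Fin k → κ × Option σ → F), SeparatedOff j y ∧
    ¬ HasEliminants M fun a => specialize j (y a) f

theorem card_isDegenerate_le [DecidableEq F] {D M K k : ℕ}
    (hMK : ∀ h : Fin k → MvPolynomial σ F, (∀ a, (h a).totalDegree ≤ k + D) →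
      Nat.card {w : Fin k → (σ × Fin (D + 1) → F) //
          ¬ HasEliminants M fun a => h a + diagonalPoly (w a)} * Fintype.card F ^ (D + 1) ≤
        K * Nat.card (σ × Fin (D + 1) → F) ^ k) :
    Nat.card {f : restrictTotalDegree (κ × Option σ) F (k + D) // IsDegenerate M k f.1} *
        Fintype.card F ^ (D + 1) ≤
      Fintype.card κ * (Fintype.card F ^ (Fintype.card κ * (Fintype.card σ + 1))) ^ k *
        (K * Nat.card (restrictTotalDegree (κ × Option σ) F (k + D))) := by
  classical
  have := Fintype.ofFinite (restrictTotalDegree (κ × Option σ) F (k + D))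
  let I := {c : κ × (Fin k → κ × Option σ → F) // SeparatedOff c.1 c.2}
  let B : I → Finset (restrictTotalDegree (κ × Option σ) F (k + D)) := fun c =>
    Finset.univ.filter fun f => ¬ HasEliminants M fun a => specialize c.1.1 (c.1.2 a) f.1
  have hsub : (Finset.univ.filter fun f : restrictTotalDegree (κ × Option σ) F (k + D) =>
      IsDegenerate M k f.1) ⊆ (Finset.univ : Finset I).biUnion B := by
    intro f hf
    obtain ⟨j, y, hy, hbad⟩ := (Finset.mem_filter.1 hf).2
    exact Finset.mem_biUnion.2 ⟨⟨(j, y), hy⟩, Finset.mem_univ _,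
      Finset.mem_filter.2 ⟨Finset.mem_univ _, hbad⟩⟩
  have hI : Fintype.card I ≤
      Fintype.card κ * (Fintype.card F ^ (Fintype.card κ * (Fintype.card σ + 1))) ^ k := by
    refine (Fintype.card_subtype_le _).trans (le_of_eq ?_)
    simp
  rw [Nat.card_eq_fintype_card, Fintype.card_subtype]
  refine (Nat.mul_le_mul_right _ ((Finset.card_le_card hsub).trans Finset.card_biUnion_le)).trans ?_
  rw [Finset.sum_mul]
  refine (Finset.sum_le_card_nsmul _ _
    (K * Nat.card (restrictTotalDegree (κ × Option σ) F (k + D))) fun c _ => ?_).trans ?_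
  · have := card_specialize_bad_le hMK c.2
    rwa [Nat.card_eq_fintype_card, Fintype.card_subtype] at this
  · rw [smul_eq_mul, Finset.card_univ]
    exact Nat.mul_le_mul_right _ hI

end Specialization

section Hypergraph

variable {V κ σ F : Type}

/-- The embedding sending each `i` to the vertex of colour `i` with coordinates `x i`. -/
def placement (e : V ≃ κ × (σ → F)) (x : κ → σ → F) : κ ↪ V where
  toFun i := e.symm (i, x i)
  inj' _ _ h := congrArg Prod.fst (e.symm.injective h)

theorem colour_placement (e : V ≃ κ × (σ → F)) (x : κ → σ → F) (i : κ) :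
    (e (placement e x i)).1 = i := by
  change (e (e.symm (i, x i))).1 = i
  rw [Equiv.apply_symm_apply]

variable [DecidableEq κ] [Field F]

/-- The block of `pointOf e X` indexed by a colour is the sum of the affine coordinates of the
vertices in `X` of that colour. -/
def pointOf (e : V → κ × (σ → F)) (X : Finset V) (i : κ × Option σ) : F :=
  ∑ w ∈ X, if (e w).1 = i.1 then affineCoords (e w).2 i.2 else 0

theorem pointOf_eq_zero {e : V → κ × (σ → F)} {X : Finset V} {i : κ × Option σ}
    (h : ∀ w ∈ X, (e w).1 ≠ i.1) : pointOf e X i = 0 :=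
  Finset.sum_eq_zero fun w hw => if_neg (h w hw)

theorem pointOf_apply_of_mem {e : V → κ × (σ → F)} {X : Finset V}
    (hX : Set.InjOn (fun w => (e w).1) X) {u : V} (hu : u ∈ X) (o : Option σ) :
    pointOf e X ((e u).1, o) = affineCoords (e u).2 o := by
  rw [pointOf, Finset.sum_eq_single u]
  · simp
  · intro w hw hwu
    exact if_neg fun h => hwu (hX hw hu h)
  · exact fun h => absurd hu h

theorem exists_pointOf_ne {e : V → κ × (σ → F)} (he : Function.Injective e) {X Y : Finset V}
    (hX : Set.InjOn (fun w => (e w).1) X) (hY : Set.InjOn (fun w => (e w).1) Y) {u : V}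
    (huX : u ∈ X) (huY : u ∉ Y) :
    ∃ o, pointOf e X ((e u).1, o) ≠ pointOf e Y ((e u).1, o) := by
  by_cases h : ∃ u' ∈ Y, (e u').1 = (e u).1
  · obtain ⟨u', hu', hc⟩ := h
    have hne : (e u).2 ≠ (e u').2 := by
      intro h2
      exact huY (he (Prod.ext hc.symm h2) ▸ hu')
    obtain ⟨t, ht⟩ := Function.ne_iff.1 hne
    refine ⟨some t, ?_⟩
    rw [pointOf_apply_of_mem hX huX, ← hc, pointOf_apply_of_mem hY hu']
    exact ht
  · push Not at h
    refine ⟨none, ?_⟩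
    rw [pointOf_apply_of_mem hX huX, pointOf_eq_zero h]
    exact one_ne_zero

theorem pointOf_insert [DecidableEq V] {e : V → κ × (σ → F)} {X : Finset V} {w : V} (hw : w ∉ X)
    (h : ∀ u ∈ X, (e u).1 ≠ (e w).1) :
    pointOf e (insert w X) =
      fun i => if i.1 = (e w).1 then affineCoords (e w).2 i.2 else pointOf e X i := by
  funext i
  rw [pointOf, Finset.sum_insert hw]
  split_ifs with h1 h2 h2
  · have : pointOf e X i = 0 := pointOf_eq_zero fun u hu => h2 ▸ h u hu
    rw [pointOf] at this
    rw [this, add_zero]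
  · exact absurd h1.symm h2
  · exact absurd h2.symm h1
  · rw [zero_add, pointOf]

open Classical in
/-- The `r`-sets of vertices of pairwise distinct colours on which `f` vanishes. -/
noncomputable def zeroEdges [Fintype V] (e : V → κ × (σ → F)) (r : ℕ)
    (f : MvPolynomial (κ × Option σ) F) : Finset (Finset V) :=
  Finset.univ.filter fun X =>
    X.card = r ∧ Set.InjOn (fun w => (e w).1) X ∧ eval (pointOf e X) f = 0

theorem mem_zeroEdges [Fintype V] {e : V → κ × (σ → F)} {r : ℕ} {f : MvPolynomial (κ × Option σ) F}
    {X : Finset V} : X ∈ zeroEdges e r f ↔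
      X.card = r ∧ Set.InjOn (fun w => (e w).1) X ∧ eval (pointOf e X) f = 0 := by
  simp [zeroEdges]

theorem not_containsCompletePartite_zeroEdges [DecidableEq V] [Fintype V] [Fintype κ] [Fintype σ]
    [DecidableEq σ] [Fintype F] [DecidableEq F] {m p M : ℕ}
    {s : Fin m → ℕ} (hs : ∏ i, s i = Fintype.card σ) {e : V → κ × (σ → F)}
    (he : Function.Injective e) {f : MvPolynomial (κ × Option σ) F}
    (hf : ¬ IsDegenerate M (Fintype.card σ) f)
    (hp : Fintype.card κ * (M + 1) ^ Fintype.card σ < p) :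
    ¬ ContainsCompletePartite (zeroEdges e (m + 1) f)
      (fun i : Fin (m + 1) => if h : (i : ℕ) < m then s ⟨i, h⟩ else p) := by
  rintro ⟨A, hdisj, hcard, hedge⟩
  have hlast : (A (Fin.last m)).card = p := by simp [hcard]
  have hinit : ∀ i : Fin m, (A i.castSucc).card = s i := by simp [hcard]
  obtain ⟨j, -, hj⟩ := Finset.exists_lt_card_fiber_of_mul_lt_card_of_maps_to
    (s := A (Fin.last m)) (t := Finset.univ) (f := fun w => (e w).1)
    (n := (M + 1) ^ Fintype.card σ) (fun _ _ => Finset.mem_univ _)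
    (by rwa [hlast, Finset.card_univ])
  have hι : Fintype.card (Fin (Fintype.card σ)) =
      Fintype.card ((i : Fin m) → A i.castSucc) := by
    rw [Fintype.card_fin, Fintype.card_pi, ← hs]
    exact Finset.prod_congr rfl fun i _ => by rw [Fintype.card_coe, hinit]
  let t := Fintype.equivOfCardEq hι
  let T : Fin (Fintype.card σ) → Finset V := fun a =>
    Finset.univ.image fun i : Fin m => (t a i : V)
  have hTmem : ∀ a u, u ∈ T a ↔ ∃ i, (t a i : V) = u := fun a u => by simp [T]
  have hTedge : ∀ a, ∀ w ∈ A (Fin.last m), insert w (T a) ∈ zeroEdges e (m + 1) f := by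
    intro a w hw
    have := hedge (Fin.snoc (α := fun _ => V) (fun i => (t a i : V)) w) fun i => by
      induction i using Fin.lastCases with
      | last => simpa using hw
      | cast i => simp
    convert this using 1
    ext u
    simp [T, Fin.exists_fin_succ', or_comm, eq_comm]
  have hTnot : ∀ a, ∀ w ∈ A (Fin.last m), w ∉ T a := by
    intro a w hw h
    obtain ⟨i, rfl⟩ := (hTmem a w).1 h
    exact Finset.disjoint_left.1 (hdisj _ _ (Fin.castSucc_lt_last i).ne) (t a i).2 hw
  have hTcol : ∀ a, ∀ w ∈ A (Fin.last m), ∀ u ∈ T a, (e u).1 ≠ (e w).1 := by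
    intro a w hw u hu h
    have := (mem_zeroEdges.1 (hTedge a w hw)).2.1 (by simp [hu]) (by simp) h
    exact hTnot a w hw (this ▸ hu)
  have hne : ((A (Fin.last m)).filter fun w => (e w).1 = j).Nonempty :=
    Finset.card_pos.1 (by omega)
  obtain ⟨w₀, hw₀⟩ := hne
  obtain ⟨hw₀A, rfl⟩ := Finset.mem_filter.1 hw₀
  have hTinj : ∀ a, Set.InjOn (fun w => (e w).1) (T a) := fun a =>
    (mem_zeroEdges.1 (hTedge a w₀ hw₀A)).2.1.mono (by simp)
  have hsep : SeparatedOff (e w₀).1 fun a => pointOf e (T a) := by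
    intro a a' haa'
    obtain ⟨i, hi⟩ := Function.ne_iff.1 (t.injective.ne haa')
    have hu : (t a i : V) ∈ T a := (hTmem _ _).2 ⟨i, rfl⟩
    have hu' : (t a i : V) ∉ T a' := by
      intro h
      obtain ⟨i', hi'⟩ := (hTmem _ _).1 h
      by_cases hii : i = i'
      · subst hii
        exact hi (Subtype.ext hi'.symm)
      · exact Finset.disjoint_left.1 (hdisj i.castSucc i'.castSucc (by simpa using hii))
          (t a i).2 (hi' ▸ (t a' i').2)
    obtain ⟨o, ho⟩ := exists_pointOf_ne he (hTinj a) (hTinj a') hu hu'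
    exact ⟨(_, o), hTcol a w₀ hw₀A _ hu, ho⟩
  have helim : HasEliminants M fun a => specialize (e w₀).1 (pointOf e (T a)) f := by
    by_contra h
    exact hf ⟨_, _, hsep, h⟩
  have hzeros := card_zeros_le_of_hasEliminants rfl helim
  refine (hj.trans_le ?_).not_ge hzeros
  rw [← Fintype.card_coe, ← Nat.card_eq_fintype_card]
  refine Nat.card_le_card_of_injective (fun w => ⟨(e w.1).2, fun a => ?_⟩) ?_
  · obtain ⟨hwA, hwj⟩ := Finset.mem_filter.1 w.2
    have := (mem_zeroEdges.1 (hTedge a w.1 hwA)).2.2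
    rw [pointOf_insert (hTnot a _ hwA) (hTcol a _ hwA)] at this
    rw [hwj] at this
    rw [eval_specialize]
    exact this
  · intro w w' h
    refine Subtype.ext (he (Prod.ext ?_ (Subtype.mk.inj h)))
    exact (Finset.mem_filter.1 w.2).2.trans (Finset.mem_filter.1 w'.2).2.symm

theorem card_vanishing_le_card_copies [Fintype V] [Finite κ] [Finite σ] [Finite F]
    (e : V ≃ κ × (σ → F)) {r : ℕ} {H : Finset (Finset κ)} (hH : ∀ E ∈ H, E.card = r)
    (f : MvPolynomial (κ × Option σ) F) :
    Nat.card {x : κ → σ → F // ∀ E ∈ H, eval (pointOf e (E.map (placement e x))) f = 0} ≤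
      Nat.card {φ : κ ↪ V // ∀ E ∈ H, E.map φ ∈ zeroEdges e r f} := by
  refine Nat.card_le_card_of_injective (fun x => ⟨placement e x.1, fun E hE =>
    mem_zeroEdges.2 ⟨by rw [Finset.card_map, hH E hE], ?_, x.2 E hE⟩⟩) ?_
  · intro w hw w' hw' h
    simp only [Finset.coe_map, Set.mem_image] at hw hw'
    obtain ⟨i, -, rfl⟩ := hw
    obtain ⟨i', -, rfl⟩ := hw'
    simp only [colour_placement] at h
    rw [h]
  · intro x x' h
    refine Subtype.ext (funext fun i => ?_)
    have := DFunLike.congr_fun (Subtype.mk.inj h) i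
    exact congrArg Prod.snd (e.symm.injective this)

theorem card_mul_card_le_sum_vanishing [Finite κ] [Finite σ] [Fintype F] {ι : Type} [Finite ι]
    (Q : ι → Finset κ → κ × Option σ → F) (H : Finset (Finset κ)) (d : ℕ)
    [Fintype (restrictTotalDegree (κ × Option σ) F d)] :
    Nat.card ι * Nat.card (restrictTotalDegree (κ × Option σ) F d) ≤
      (∑ f : restrictTotalDegree (κ × Option σ) F d,
        Nat.card {x // ∀ E ∈ H, eval (Q x E) f.1 = 0}) * Fintype.card F ^ H.card := by
  have := card_mul_card_le_sum_card_ker fun x : ι =>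
    AddMonoidHom.mk' (fun (f : restrictTotalDegree (κ × Option σ) F d) (E : H) =>
      eval (Q x E) f.1) (by intros; ext; simp)
  simpa [funext_iff, Nat.card_fun] using this

theorem exists_nondegenerate_of_card_le [Fintype F] [DecidableEq F] {v b M K : ℕ}
    (H : Finset (Finset (Fin v)))
    (hMK : ∀ h : Fin b → MvPolynomial (Fin b) F,
      (∀ a, (h a).totalDegree ≤ b + (v * (b + 1) * b + H.card)) →
      Nat.card {w : Fin b → (Fin b × Fin (v * (b + 1) * b + H.card + 1) → F) //
          ¬ HasEliminants M fun a => h a + diagonalPoly (w a)} *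
          Fintype.card F ^ (v * (b + 1) * b + H.card + 1) ≤
        K * Nat.card (Fin b × Fin (v * (b + 1) * b + H.card + 1) → F) ^ b)
    (hq : 2 * v * K ≤ Fintype.card F) (e : V ≃ Fin v × (Fin b → F)) :
    ∃ f : MvPolynomial (Fin v × Option (Fin b)) F, ¬ IsDegenerate M b f ∧
      Fintype.card F ^ (b * v) ≤
        2 * Nat.card {x : Fin v → Fin b → F //
          ∀ E ∈ H, eval (pointOf e (E.map (placement e x))) f = 0} *
          Fintype.card F ^ H.card := by
  have hqpos : 0 < Fintype.card F := Fintype.card_pos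
  have hdeg := card_isDegenerate_le (κ := Fin v) hMK
  simp only [Fintype.card_fin] at hdeg
  have hB : 2 * Nat.card {f : restrictTotalDegree (Fin v × Option (Fin b)) F
      (b + (v * (b + 1) * b + H.card)) // IsDegenerate M b f.1} * Fintype.card F ^ H.card ≤
      Nat.card (restrictTotalDegree (Fin v × Option (Fin b)) F
        (b + (v * (b + 1) * b + H.card))) := by
    generalize Nat.card {f : restrictTotalDegree (Fin v × Option (Fin b)) F
      (b + (v * (b + 1) * b + H.card)) // IsDegenerate M b f.1} = Z at hdeg ⊢
    generalize Nat.card (restrictTotalDegree (Fin v × Option (Fin b)) F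
        (b + (v * (b + 1) * b + H.card))) = N at hdeg ⊢
    generalize Fintype.card F = q at hdeg hq hqpos ⊢
    refine Nat.le_of_mul_le_mul_left ?_ (pow_pos hqpos (v * (b + 1) * b + 1))
    calc q ^ (v * (b + 1) * b + 1) * (2 * Z * q ^ H.card)
        = 2 * (Z * q ^ (v * (b + 1) * b + H.card + 1)) := by ring
      _ ≤ 2 * (v * (q ^ (v * (b + 1))) ^ b * (K * N)) := Nat.mul_le_mul_left _ hdeg
      _ = 2 * v * K * (q ^ (v * (b + 1) * b) * N) := by rw [← pow_mul]; ring
      _ ≤ q * (q ^ (v * (b + 1) * b) * N) := Nat.mul_le_mul_right _ hq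
      _ = q ^ (v * (b + 1) * b + 1) * N := by ring
  obtain ⟨f, hf, hcard⟩ := exists_large_of_sparse
    (fun f : restrictTotalDegree (Fin v × Option (Fin b)) F
      (b + (v * (b + 1) * b + H.card)) => Nat.card {x : Fin v → Fin b → F //
        ∀ E ∈ H, eval (pointOf e (E.map (placement e x))) f.1 = 0})
    (fun f => IsDegenerate M b f.1) (N := Nat.card (Fin v → Fin b → F))
    (pow_pos hqpos H.card) (fun f => Finite.card_subtype_le _)
    (card_mul_card_le_sum_vanishing (fun x E => pointOf e (E.map (placement e x))) H _) hB
  refine ⟨f.1, hf, ?_⟩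
  simpa [Nat.card_fun, ← pow_mul] using hcard

end Hypergraph

end RandomAlgebraic

/-- Theorem 1.4 (lower bound): for any `r`-uniform hypergraph `H` (`r = m+1`)
with `v` vertices and `e` edges there is `c` such that for every `p ≥ c` and
infinitely many `n` there is an `n`-vertex `K^{(r)}_{s_1,…,s_{r-1},p}`-free
`r`-uniform hypergraph containing at least `Ω(n^{v - e/(s_1⋯s_{r-1})})`
copies of `H`. -/
theorem random_algebraic_lower_bound
    (m : ℕ) (s : Fin m → ℕ) (hs : ∀ i, 0 < s i)
    (v : ℕ) (H : Finset (Finset (Fin v))) (hH : ∀ f ∈ H, f.card = m + 1) :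
    ∃ c : ℕ, ∀ p : ℕ, c ≤ p →
      ∃ C : ℝ, 0 < C ∧ ∀ n₀ : ℕ, ∃ n : ℕ, n₀ ≤ n ∧
        ∃ G : Finset (Finset (Fin n)),
          (∀ f ∈ G, f.card = m + 1) ∧
          ¬ ContainsCompletePartite G
              (fun i : Fin (m + 1) => if h : (i : ℕ) < m then s ⟨i, h⟩ else p) ∧
          C * (n : ℝ) ^ ((v : ℝ) - (H.card : ℝ) / ∏ i, (s i : ℝ)) ≤
            (Nat.card {φ : Fin v ↪ Fin n // ∀ f ∈ H, f.map φ ∈ G} : ℝ) := by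
  rcases Nat.eq_zero_or_pos v with rfl | hv
  · have hHempty : H = ∅ := by
      refine Finset.eq_empty_of_forall_notMem fun E hE => ?_
      have := hH E hE
      rw [Finset.eq_empty_of_isEmpty E, Finset.card_empty] at this
      omega
    subst hHempty
    refine ⟨1, fun p hp => ⟨1, one_pos, fun n₀ => ⟨n₀, le_rfl, ∅, by simp, ?_, ?_⟩⟩⟩
    · rintro ⟨A, -, hcard, hedge⟩
      have hne : ∀ i, (A i).Nonempty := by
        intro i
        rw [← Finset.card_pos, hcard]
        dsimp only
        split_ifs
        exacts [hs _, hp]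
      choose g hg using hne
      exact Finset.notMem_empty _ (hedge g hg)
    · simp
  obtain ⟨b, hb⟩ : ∃ b, ∏ i, s i = b := ⟨_, rfl⟩
  have hbpos : 0 < b := hb ▸ Finset.prod_pos fun i _ => hs i
  have hbreal : ∏ i, (s i : ℝ) = b := by rw [← hb, Nat.cast_prod]
  rw [hbreal]
  obtain ⟨M, K, hMK⟩ := RandomAlgebraic.exists_card_not_hasEliminants_le (Fin b)
    (v * (b + 1) * b + H.card) (b + (v * (b + 1) * b + H.card)) b (by simp)
  refine ⟨v * (M + 1) ^ b + 1, fun p hp => ?_⟩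
  have hvpow : 0 < (v : ℝ) ^ ((v : ℝ) - (H.card : ℝ) / b) :=
    Real.rpow_pos_of_pos (Nat.cast_pos.2 hv) _
  refine ⟨1 / (2 * (v : ℝ) ^ ((v : ℝ) - (H.card : ℝ) / b)), by positivity, fun n₀ => ?_⟩
  obtain ⟨q, hq, hqprime⟩ := Nat.exists_infinite_primes (n₀ + 2 * v * K)
  have := Fact.mk hqprime
  have hqpos := hqprime.pos
  have hcardV : Fintype.card (Fin (v * q ^ b)) = Fintype.card (Fin v × (Fin b → ZMod q)) := by
    simp
  let e := Fintype.equivOfCardEq hcardV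
  obtain ⟨f, hf, hfcopies⟩ := RandomAlgebraic.exists_nondegenerate_of_card_le
    (b := b) (M := M) (K := K) H (hMK (ZMod q)) (by rw [ZMod.card]; omega) e
  have hle : n₀ ≤ v * q ^ b :=
    calc n₀ ≤ q := by omega
      _ ≤ q ^ b := Nat.le_self_pow hbpos.ne' q
      _ ≤ v * q ^ b := Nat.le_mul_of_pos_left _ hv
  refine ⟨v * q ^ b, hle, RandomAlgebraic.zeroEdges e (m + 1) f,
    fun X hX => (RandomAlgebraic.mem_zeroEdges.1 hX).1, ?_, ?_⟩
  · refine RandomAlgebraic.not_containsCompletePartite_zeroEdges (M := M) (by simpa using hb)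
      e.injective (by simpa using hf) (by simpa using hp)
  have hcopies := RandomAlgebraic.card_vanishing_le_card_copies e hH f
  rw [ZMod.card] at hfcopies
  have hN : (q : ℝ) ^ (b * v) ≤ 2 *
      (Nat.card {φ : Fin v ↪ Fin (v * q ^ b) //
        ∀ E ∈ H, E.map φ ∈ RandomAlgebraic.zeroEdges e (m + 1) f} : ℝ) * (q : ℝ) ^ H.card := by
    exact_mod_cast hfcopies.trans (by gcongr)
  have hqreal : (0 : ℝ) < q := Nat.cast_pos.2 hqpos
  have hpow : ((q : ℝ) ^ b) ^ ((v : ℝ) - (H.card : ℝ) / b) = q ^ (b * v) / q ^ H.card := by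
    rw [← Real.rpow_natCast, ← Real.rpow_mul hqreal.le, mul_sub,
      mul_div_cancel₀ _ (Nat.cast_ne_zero.2 hbpos.ne'), Real.rpow_sub hqreal,
      ← Nat.cast_mul, Real.rpow_natCast, Real.rpow_natCast]
  rw [Nat.cast_mul, Nat.cast_pow, Real.mul_rpow (by positivity) (by positivity), hpow]
  calc 1 / (2 * (v : ℝ) ^ ((v : ℝ) - (H.card : ℝ) / b)) *
        ((v : ℝ) ^ ((v : ℝ) - (H.card : ℝ) / b) * ((q : ℝ) ^ (b * v) / (q : ℝ) ^ H.card))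
      = (q : ℝ) ^ (b * v) / (q : ℝ) ^ H.card / 2 := by field_simp
    _ ≤ _ := by
      rw [div_div, div_le_iff₀ (by positivity)]
      linarith
end

section
/- Let s_1 ≤ s_2 ≤ ⋯ ≤ s_{r-1} be positive integers. Then there exists a constant c such that for every integer p ≥ c there exist constants C_2 > C_1 > 0 with C_1 · n^{r - 1/(s_1 ⋯ s_{r-1})} ≤ ex(n, K^{(r)}_{s_1,...,s_{r-1},p}) ≤ C_2 · n^{r - 1/(s_1 ⋯ s_{r-1})} for all sufficiently large n. -/
/-- If the values at `t` points of a valuation ring with pairwise unit differences of a polynomial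
with `t` coefficients all lie in the valuation ring, then so do the coefficients. -/
lemma ValuationSubring.mem_of_sum_pow_mul_mem {E : Type*} [Field E] (V : ValuationSubring E)
    {t : ℕ} (α : Fin t → V) (hα : ∀ i i', i ≠ i' → IsUnit (α i - α i')) (y : Fin t → E)
    (h : ∀ i, ∑ l : Fin t, (α i : E) ^ (l : ℕ) * y l ∈ V) (l : Fin t) : y l ∈ V := by
  have hdet : IsUnit (Matrix.vandermonde α).det := by
    rw [Matrix.det_vandermonde]
    simp only [IsUnit.prod_iff]
    intro i _ j hj
    refine hα _ _ ?_
    exact (Finset.mem_Ioi.1 hj).ne'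
  have hinv : ((Matrix.vandermonde α)⁻¹.map V.subtype) * ((Matrix.vandermonde α).map V.subtype)
      = 1 := by
    rw [← Matrix.map_mul, Matrix.nonsing_inv_mul _ hdet]
    simp
  have hy : y = ((Matrix.vandermonde α)⁻¹.map V.subtype).mulVec
      (((Matrix.vandermonde α).map V.subtype).mulVec y) := by
    rw [Matrix.mulVec_mulVec, hinv, Matrix.one_mulVec]
  rw [hy]
  change ∑ i, (((Matrix.vandermonde α)⁻¹ l i : V) : E) *
    ((Matrix.vandermonde α).map V.subtype).mulVec y i ∈ V
  refine sum_mem fun i _ => V.mul_mem _ _ (SetLike.coe_mem ((Matrix.vandermonde α)⁻¹ l i)) ?_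
  simpa [Matrix.mulVec, dotProduct, Matrix.vandermonde_apply] using h i

/-- The valuative criterion behind the finiteness of the fibres of a system of products of
affine forms. -/
lemma ValuationSubring.mem_of_prod_affine_mem {E : Type*} [Field E] (V : ValuationSubring E)
    {t T : ℕ} (htT : t ≤ T) (α : Fin T → V) (hα : ∀ i i', i ≠ i' → IsUnit (α i - α i'))
    (a : Fin T → Fin t → V) (ha : ∀ i j j', j ≠ j' → IsUnit (a i j - a i j')) (y : Fin t → E)
    (h : ∀ j, ∏ i, (∑ l : Fin t, (α i : E) ^ (l : ℕ) * y l + a i j) ∈ V) (l : Fin t) :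
    y l ∈ V := by
  classical
  by_contra hl
  set Y : Fin T → E := fun i => ∑ l : Fin t, (α i : E) ^ (l : ℕ) * y l with hY
  set S : Finset (Fin T) := Finset.univ.filter fun i => Y i ∈ V with hS
  have hcard : S.card < t := by
    by_contra hc
    push Not at hc
    obtain ⟨S', hS', hS'c⟩ := Finset.exists_subset_card_eq hc
    refine hl (V.mem_of_sum_pow_mul_mem (fun i => α (S'.orderEmbOfFin hS'c i))
      (fun i i' hii => hα _ _ (by simpa using hii)) y (fun i => ?_) l)
    have := hS' (S'.orderEmbOfFin_mem hS'c i)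
    exact (Finset.mem_filter.1 this).2
  have key : ∀ j, ∃ i ∈ S, V.valuation (Y i + a i j) < 1 := by
    intro j
    by_contra! hj
    have hbig : ∀ i, i ∉ S → 1 < V.valuation (Y i + a i j) := by
      intro i hi
      rw [← not_le, V.valuation_le_one_iff]
      intro hmem
      refine hi (Finset.mem_filter.2 ⟨Finset.mem_univ _, ?_⟩)
      simpa using sub_mem hmem (a i j).2
    have hprod := (V.valuation_le_one_iff _).2 (h j)
    rw [map_prod] at hprod
    have hone : ∀ i, 1 ≤ V.valuation (Y i + a i j) := fun i => by
      by_cases hi : i ∈ S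
      · exact hj i hi
      · exact (hbig i hi).le
    obtain ⟨i, hi⟩ : ∃ i, i ∉ S := by
      by_contra! hall
      have : S = Finset.univ := Finset.eq_univ_of_forall hall
      rw [this, Finset.card_univ, Fintype.card_fin] at hcard
      omega
    rw [← Finset.mul_prod_erase _ _ (Finset.mem_univ i)] at hprod
    have h1 : 1 ≤ ∏ x ∈ Finset.univ.erase i, V.valuation (Y x + a x j) :=
      Finset.one_le_prod' fun i _ => hone i
    have h2 := hbig i hi
    exact absurd hprod (not_le.2 (h2.trans_le (le_mul_of_one_le_right' h1)))
  choose f hfS hf using key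
  obtain ⟨j, -, j', -, hne, heq⟩ := Finset.exists_ne_map_eq_of_card_lt_of_maps_to
    (s := Finset.univ) (t := S) (by simpa using hcard) (f := f) (fun j _ => hfS j)
  have hu := ha (f j) j j' hne
  have h1 := hf j
  have h2 := hf j'
  rw [← heq] at h2
  have h3 : V.valuation ((a (f j) j : E) - a (f j) j') < 1 := by
    have := Valuation.map_sub_lt V.valuation h1 h2
    simpa using this
  have h4 := (V.valuation_eq_one_iff (a (f j) j - a (f j) j')).1 hu
  push_cast at h4
  exact h3.ne h4

/-- The product of all differences that have to be inverted. -/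
noncomputable def affineDisc {A : Type*} [CommRing A] {t T : ℕ} (α : Fin T → A)
    (a : Fin T → Fin t → A) : A :=
  (∏ p ∈ (Finset.univ : Finset (Fin T)).offDiag, (α p.1 - α p.2)) *
    ∏ i, ∏ p ∈ (Finset.univ : Finset (Fin t)).offDiag, (a i p.1 - a i p.2)

lemma map_affineDisc {A B : Type*} [CommRing A] [CommRing B] (φ : A →+* B) {t T : ℕ}
    (α : Fin T → A) (a : Fin T → Fin t → A) :
    φ (affineDisc α a) = affineDisc (fun i => φ (α i)) (fun i j => φ (a i j)) := by
  simp [affineDisc, map_prod]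

lemma affineDisc_ne_zero {A : Type*} [CommRing A] [IsDomain A] {t T : ℕ} {α : Fin T → A}
    {a : Fin T → Fin t → A} (hα : Function.Injective α) (ha : ∀ i, Function.Injective (a i)) :
    affineDisc α a ≠ 0 := by
  refine mul_ne_zero (Finset.prod_ne_zero_iff.2 fun p hp => ?_)
    (Finset.prod_ne_zero_iff.2 fun i _ => Finset.prod_ne_zero_iff.2 fun p hp => ?_)
  · exact sub_ne_zero.2 (hα.ne (Finset.mem_offDiag.1 hp).2.2)
  · exact sub_ne_zero.2 ((ha i).ne (Finset.mem_offDiag.1 hp).2.2)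

lemma isUnit_sub_of_isUnit_affineDisc {A : Type*} [CommRing A] {t T : ℕ} {α : Fin T → A}
    {a : Fin T → Fin t → A} (h : IsUnit (affineDisc α a)) :
    (∀ i i', i ≠ i' → IsUnit (α i - α i')) ∧ ∀ i j j', j ≠ j' → IsUnit (a i j - a i j') := by
  obtain ⟨h1, h2⟩ := IsUnit.mul_iff.1 h
  refine ⟨fun i i' hi => ?_, fun i j j' hj => ?_⟩
  · exact isUnit_of_dvd_unit
      (Finset.dvd_prod_of_mem (fun p : Fin T × Fin T => α p.1 - α p.2) (a := (i, i'))
        (by simpa using hi)) h1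
  · exact isUnit_of_dvd_unit
      ((Finset.dvd_prod_of_mem (fun p : Fin t × Fin t => a i p.1 - a i p.2) (a := (j, j'))
        (by simpa using hj)).trans
      (Finset.dvd_prod_of_mem (fun i => ∏ p ∈ (Finset.univ : Finset (Fin t)).offDiag,
        (a i p.1 - a i p.2)) (Finset.mem_univ i))) h2

/-- The values of the products of affine forms at `y`. -/
def affineProd {A : Type*} [CommRing A] {t T : ℕ} (α : Fin T → A)
    (a : Fin T → Fin t → A) (y : Fin t → A) (j : Fin t) : A :=
  ∏ i, (∑ l : Fin t, α i ^ (l : ℕ) * y l + a i j)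

lemma map_affineProd {A B : Type*} [CommRing A] [CommRing B] (φ : A →+* B) {t T : ℕ}
    (α : Fin T → A) (a : Fin T → Fin t → A) (y : Fin t → A) (j : Fin t) :
    φ (affineProd α a y j) =
      affineProd (fun i => φ (α i)) (fun i j => φ (a i j)) (fun l => φ (y l)) j := by
  simp [affineProd, map_prod]

/-- Evaluation of integer polynomials in the parameters of a system of products of affine forms,
namely `α`, `a`, the prescribed values `b` and an inverse `w` of the discriminant. -/
noncomputable def affineParamHom {A : Type*} [CommRing A] {t T : ℕ} (α : Fin T → A)
    (a : Fin T → Fin t → A) (b : Fin t → A) (w : A) :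
    MvPolynomial (Fin T ⊕ (Fin T × Fin t) ⊕ Fin t ⊕ Unit) ℤ →+* A :=
  MvPolynomial.eval₂Hom (Int.castRingHom A)
    (Sum.elim α (Sum.elim (fun p => a p.1 p.2) (Sum.elim b fun _ => w)))

lemma comp_affineParamHom {A B : Type*} [CommRing A] [CommRing B] (φ : A →+* B) {t T : ℕ}
    (α : Fin T → A) (a : Fin T → Fin t → A) (b : Fin t → A) (w : A) :
    φ.comp (affineParamHom α a b w) =
      affineParamHom (fun i => φ (α i)) (fun i j => φ (a i j)) (fun j => φ (b j)) (φ w) := by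
  refine MvPolynomial.ringHom_ext (fun n => by simp) ?_
  rintro (i | p | j | u) <;> simp [affineParamHom]

/-- Over a field, the coordinates of `y` are integral over the parameters. -/
lemma isIntegralElem_affineParamHom {E : Type*} [Field E] {t T : ℕ} (htT : t ≤ T)
    (α : Fin T → E) (a : Fin T → Fin t → E) (y : Fin t → E) (hΔ : affineDisc α a ≠ 0)
    (l : Fin t) :
    (affineParamHom α a (affineProd α a y) (affineDisc α a)⁻¹).IsIntegralElem (y l) := by
  set φ := affineParamHom α a (affineProd α a y) (affineDisc α a)⁻¹ with hφ
  have hα : ∀ i, α i ∈ φ.range := fun i => ⟨MvPolynomial.X (.inl i), by simp [φ, affineParamHom]⟩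
  have ha : ∀ i j, a i j ∈ φ.range := fun i j =>
    ⟨MvPolynomial.X (.inr (.inl (i, j))), by simp [φ, affineParamHom]⟩
  have hb : ∀ j, affineProd α a y j ∈ φ.range := fun j =>
    ⟨MvPolynomial.X (.inr (.inr (.inl j))), by simp [φ, affineParamHom]⟩
  have hw : (affineDisc α a)⁻¹ ∈ φ.range :=
    ⟨MvPolynomial.X (.inr (.inr (.inr ()))), by simp [φ, affineParamHom]⟩
  have hmem : y l ∈ (integralClosure (Subring.closure (φ.range : Set E)) E).toSubring := by
    rw [← iInf_valuationSubring_superset, Subring.mem_iInf]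
    rintro ⟨V, hV⟩
    let α' : Fin T → V := fun i => ⟨α i, hV (hα i)⟩
    let a' : Fin T → Fin t → V := fun i j => ⟨a i j, hV (ha i j)⟩
    have hdisc : ((affineDisc α' a' : V) : E) = affineDisc α a :=
      map_affineDisc V.subtype α' a'
    have hunit : IsUnit (affineDisc α' a') := by
      refine IsUnit.of_mul_eq_one ⟨(affineDisc α a)⁻¹, hV hw⟩ (Subtype.ext ?_)
      simp [hdisc, hΔ]
    obtain ⟨h1, h2⟩ := isUnit_sub_of_isUnit_affineDisc hunit
    exact V.mem_of_prod_affine_mem htT α' h1 a' h2 y (fun j => hV (hb j)) l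
  rw [Subring.closure_eq] at hmem
  obtain ⟨p, hp, hp0⟩ := hmem
  obtain ⟨q, hq, -, hqm⟩ := Polynomial.lifts_and_natDegree_eq_and_monic
    (f := φ.rangeRestrict) (p := p)
    ((Polynomial.mem_lifts _).2 (Polynomial.map_surjective _ φ.rangeRestrict_surjective p)) hp
  refine ⟨q, hqm, ?_⟩
  rw [← hq, Polynomial.eval₂_map] at hp0
  exact hp0

/-- Universal monic equations for the coordinates of a solution of a system of products of
affine forms. -/
lemma exists_monic_eval₂_affineParamHom_eq_zero {t T : ℕ} (htT : t ≤ T) (l : Fin t) :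
    ∃ p : Polynomial (MvPolynomial (Fin T ⊕ (Fin T × Fin t) ⊕ Fin t ⊕ Unit) ℤ), p.Monic ∧
      ∀ (K : Type) [Field K] (α : Fin T → K) (a : Fin T → Fin t → K) (y : Fin t → K),
        affineDisc α a ≠ 0 →
        p.eval₂ (affineParamHom α a (affineProd α a y) (affineDisc α a)⁻¹) (y l) = 0 := by
  let R := MvPolynomial (Fin T ⊕ (Fin T × Fin t) ⊕ Fin t) ℤ
  let α₀ : Fin T → R := fun i => MvPolynomial.X (.inl i)
  let a₀ : Fin T → Fin t → R := fun i j => MvPolynomial.X (.inr (.inl (i, j)))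
  let y₀ : Fin t → R := fun l => MvPolynomial.X (.inr (.inr l))
  have hΔ₀ : affineDisc α₀ a₀ ≠ 0 := affineDisc_ne_zero
    (fun i i' h => by simpa using MvPolynomial.X_injective h)
    (fun i j j' h => by simpa using MvPolynomial.X_injective h)
  let S := Localization.Away (affineDisc α₀ a₀)
  have hle : Submonoid.powers (affineDisc α₀ a₀) ≤ nonZeroDivisors R :=
    powers_le_nonZeroDivisors_of_noZeroDivisors hΔ₀
  have : IsDomain S := IsLocalization.isDomain_localization hle
  let E := FractionRing S
  let ι : R →+* S := algebraMap R S
  let κ : S →+* E := algebraMap S E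
  let w₀ : S := IsLocalization.Away.invSelf (affineDisc α₀ a₀)
  have hw₀ : ι (affineDisc α₀ a₀) * w₀ = 1 := IsLocalization.Away.mul_invSelf _
  have hκ : Function.Injective κ := IsFractionRing.injective S E
  let φ := affineParamHom (fun i => ι (α₀ i)) (fun i j => ι (a₀ i j))
    (fun j => ι (affineProd α₀ a₀ y₀ j)) w₀
  have hdiscE : affineDisc (fun i => κ (ι (α₀ i))) (fun i j => κ (ι (a₀ i j))) =
      κ (ι (affineDisc α₀ a₀)) := (map_affineDisc (κ.comp ι) α₀ a₀).symm
  have hint := isIntegralElem_affineParamHom htT (fun i => κ (ι (α₀ i)))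
    (fun i j => κ (ι (a₀ i j))) (fun l => κ (ι (y₀ l)))
    (by
      rw [hdiscE]
      exact fun h => left_ne_zero_of_mul_eq_one hw₀ (hκ (h.trans (map_zero κ).symm))) l
  have hφE : κ.comp φ = affineParamHom (fun i => κ (ι (α₀ i))) (fun i j => κ (ι (a₀ i j)))
      (affineProd (fun i => κ (ι (α₀ i))) (fun i j => κ (ι (a₀ i j))) (fun l => κ (ι (y₀ l))))
      (affineDisc (fun i => κ (ι (α₀ i))) (fun i j => κ (ι (a₀ i j))))⁻¹ := by
    rw [comp_affineParamHom]
    congr 1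
    · funext j
      exact map_affineProd (κ.comp ι) α₀ a₀ y₀ j
    · rw [hdiscE]
      refine eq_inv_of_mul_eq_one_right ?_
      rw [← map_mul, hw₀, map_one]
  rw [← hφE] at hint
  obtain ⟨p, hp, hp0⟩ := hint
  refine ⟨p, hp, fun K _ α a y hΔ => ?_⟩
  have hp1 : p.eval₂ φ (ι (y₀ l)) = 0 := by
    refine hκ ?_
    rw [Polynomial.hom_eval₂, map_zero]
    exact hp0
  let ev : R →+* K := MvPolynomial.eval₂Hom (Int.castRingHom K)
    (Sum.elim α (Sum.elim (fun p => a p.1 p.2) y))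
  have evα : ∀ i, ev (α₀ i) = α i := fun i => MvPolynomial.eval₂_X _ _ _
  have eva : ∀ i j, ev (a₀ i j) = a i j := fun i j => MvPolynomial.eval₂_X _ _ _
  have evy : ∀ l, ev (y₀ l) = y l := fun l => MvPolynomial.eval₂_X _ _ _
  have evΔ : ev (affineDisc α₀ a₀) = affineDisc α a := by
    rw [map_affineDisc]; simp only [evα, eva]
  let ψ : S →+* K := IsLocalization.Away.lift (S := S) (affineDisc α₀ a₀) (g := ev)
    (by rw [evΔ]; exact hΔ.isUnit)
  have hψ : ∀ x, ψ (ι x) = ev x := fun x => IsLocalization.Away.lift_eq _ _ x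
  have hψφ : ψ.comp φ = affineParamHom α a (affineProd α a y) (affineDisc α a)⁻¹ := by
    rw [comp_affineParamHom]
    congr 1
    · funext i; rw [hψ, evα]
    · funext i j; rw [hψ, eva]
    · funext j; rw [hψ, map_affineProd]; simp only [evα, eva, evy]
    · refine eq_inv_of_mul_eq_one_right ?_
      rw [← evΔ, ← hψ, ← map_mul, hw₀, map_one]
  have := congrArg ψ hp1
  rwa [Polynomial.hom_eval₂, hψφ, hψ, evy, map_zero] at this

/-- A system of `t` products of affine forms in `t` variables has a number of solutions bounded
independently of the field. -/
lemma exists_bound_card_affineProd_eq {t T : ℕ} (htT : t ≤ T) :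
    ∃ D : ℕ, ∀ (K : Type) [Field K] (α : Fin T → K) (a : Fin T → Fin t → K) (b : Fin t → K),
      Function.Injective α → (∀ i, Function.Injective (a i)) →
      ∀ Y : Finset (Fin t → K), (∀ y ∈ Y, affineProd α a y = b) → Y.card ≤ D := by
  classical
  choose p hp hp0 using fun l : Fin t => exists_monic_eval₂_affineParamHom_eq_zero htT l
  refine ⟨∏ l, (p l).natDegree, fun K _ α a b hα ha Y hY => ?_⟩
  have hΔ := affineDisc_ne_zero hα ha
  let P : Fin t → Polynomial K := fun l => (p l).map (affineParamHom α a b (affineDisc α a)⁻¹)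
  have hsub : Y ⊆ Fintype.piFinset fun l => (P l).roots.toFinset := by
    intro y hy
    refine Fintype.mem_piFinset.2 fun l => ?_
    rw [Multiset.mem_toFinset, Polynomial.mem_roots ((hp l).map _).ne_zero, Polynomial.IsRoot,
      Polynomial.eval_map, ← hY y hy]
    exact hp0 l K α a y hΔ
  refine (Finset.card_le_card hsub).trans ?_
  rw [Fintype.card_piFinset]
  refine Finset.prod_le_prod' fun l _ => ?_
  refine (Multiset.toFinset_card_le _).trans ((Polynomial.card_roots' _).trans ?_)
  exact Polynomial.natDegree_map_le

/-- For a finite extension `L / F` of finite fields of degree `r * t`, the norm of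
`∑ k, ∑ l, x k l • α ^ (l + t * k)`, where `α` generates `L`, defines an `r`-partite equation
in which few points of any part satisfy `t` distinct equations. -/
lemma exists_norm_form {r t : ℕ} (hr : 2 ≤ r) (ht : 0 < t) :
    ∃ D : ℕ, ∀ (F L : Type) [Field F] [Field L] [Algebra F L] [Finite L],
      Module.finrank F L = r * t → ∃ Φ : Fin r × (Fin t → F) → L,
      (Function.Injective fun x : Fin r → Fin t → F => ∑ k, Φ (k, x k)) ∧
      ∀ (k : Fin r) (u : Fin t → L) (b : F) (Y : Finset (Fin t → F)),
        Function.Injective u → (∀ y ∈ Y, ∀ j, Algebra.norm F (Φ (k, y) + u j) = b) →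
        Y.card ≤ D := by
  classical
  have htT : t ≤ r * t := Nat.le_mul_of_pos_left t (by omega)
  have h1T : 1 < r * t := by nlinarith
  obtain ⟨D, hD⟩ := exists_bound_card_affineProd_eq htT
  refine ⟨D, fun F L _ _ _ _ hfin => ?_⟩
  have : Finite F := Finite.of_injective _ (algebraMap F L).injective
  let pb : PowerBasis F L := Field.powerBasisOfFiniteOfSeparable F L
  have hdim : pb.dim = r * t := by rw [← hfin, pb.finrank]
  set α : L := pb.gen with hα
  have hα0 : α ≠ 0 := by
    have := pb.basis.ne_zero ⟨1, by omega⟩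
    simpa using this
  let e : Fin (r * t) ≃ Gal(L/F) := (Fintype.equivFinOfCardEq (by
    rw [← Nat.card_eq_fintype_card, IsGalois.card_aut_eq_finrank, hfin])).symm
  let Φ : Fin r × (Fin t → F) → L := fun p =>
    ∑ l : Fin t, algebraMap F L (p.2 l) * α ^ ((l : ℕ) + t * p.1)
  refine ⟨Φ, ?_, ?_⟩
  · have hli : LinearIndependent F fun p : Fin r × Fin t => α ^ ((p.2 : ℕ) + t * p.1) := by
      have h := pb.basis.linearIndependent.comp
        (fun p : Fin r × Fin t => Fin.cast hdim.symm (finProdFinEquiv p))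
        ((Fin.cast_injective _).comp finProdFinEquiv.injective)
      have heq : (fun p : Fin r × Fin t => α ^ ((p.2 : ℕ) + t * p.1)) =
          pb.basis ∘ fun p : Fin r × Fin t => Fin.cast hdim.symm (finProdFinEquiv p) := by
        funext p
        simp [finProdFinEquiv, hα]
      rw [heq]
      exact h
    intro x x' h
    have h0 : ∑ p : Fin r × Fin t, (x p.1 p.2 - x' p.1 p.2) • α ^ ((p.2 : ℕ) + t * p.1) = 0 := by
      simp only [Algebra.smul_def, map_sub, sub_mul, Finset.sum_sub_distrib,
        Fintype.sum_prod_type]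
      exact sub_eq_zero.2 h
    funext k l
    exact sub_eq_zero.1 (Fintype.linearIndependent_iff.1 hli _ h0 (k, l))
  · intro k u b Y hu hY
    let c : L := (α ^ (t * (k : ℕ)))⁻¹
    have hc0 : c ≠ 0 := inv_ne_zero (pow_ne_zero _ hα0)
    have hcΦ : ∀ y : Fin t → F,
        c * Φ (k, y) = ∑ l : Fin t, α ^ (l : ℕ) * algebraMap F L (y l) := by
      intro y
      simp only [Φ, Finset.mul_sum, c, pow_add]
      refine Finset.sum_congr rfl fun l _ => ?_
      field_simp
    have hinj : Function.Injective fun (y : Fin t → F) (l : Fin t) => algebraMap F L (y l) :=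
      (algebraMap F L).injective.comp_left
    rw [← Finset.card_image_of_injective Y hinj]
    refine hD L (fun i => e i α) (fun i j => e i (c * u j))
      (fun _ => algebraMap F L (Algebra.norm F c * b)) ?_ ?_ _ ?_
    · intro i i' h
      refine e.injective (AlgEquiv.coe_toAlgHom_injective (pb.algHom_ext ?_))
      exact h
    · exact fun i => (e i).injective.comp ((mul_right_injective₀ hc0).comp hu)
    · intro z hz
      obtain ⟨y, hy, rfl⟩ := Finset.mem_image.1 hz
      funext j
      rw [← hY y hy j, ← map_mul, Algebra.norm_eq_prod_automorphisms, mul_add, hcΦ,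
        ← e.prod_comp, affineProd]
      simp

/-- Dense hypergraphs without a large complete partite subhypergraph. -/
lemma exists_norm_hypergraph (m : ℕ) (hm : 1 ≤ m) (s : Fin m → ℕ) (hs : ∀ i, 0 < s i) :
    ∃ c : ℕ, 0 < c ∧ ∀ p : ℕ, c ≤ p → ∀ q n : ℕ, q.Prime → (m + 1) * q ^ (∏ i, s i) ≤ n →
      ∃ G : Finset (Finset (Fin n)), (∀ f ∈ G, f.card = m + 1) ∧
        ¬ ContainsCompletePartite G
          (fun i : Fin (m + 1) => if h : (i : ℕ) < m then s ⟨i, h⟩ else p) ∧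
        q ^ ((m + 1) * (∏ i, s i) - 1) ≤ G.card := by
  classical
  set t := ∏ i, s i with ht
  have ht0 : 0 < t := Finset.prod_pos fun i _ => hs i
  obtain ⟨D, hD⟩ := exists_norm_form (r := m + 1) (by omega) ht0
  refine ⟨(m + 1) * D + 1, by omega, fun p hp q n hq hn => ?_⟩
  have : Fact q.Prime := ⟨hq⟩
  obtain ⟨Φ, hinj, hfew⟩ := hD (ZMod q) (GaloisField q ((m + 1) * t))
    (GaloisField.finrank q (mul_ne_zero (by omega) ht0.ne'))
  let N := Algebra.norm (ZMod q) (S := GaloisField q ((m + 1) * t))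
  obtain ⟨emb⟩ : Nonempty (Fin (m + 1) × (Fin t → ZMod q) ↪ Fin n) := by
    refine Function.Embedding.nonempty_of_card_le ?_
    simpa [ZMod.card] using hn
  let z : (Fin (m + 1) → Fin t → ZMod q) → GaloisField q ((m + 1) * t) :=
    fun x => ∑ k, Φ (k, x k)
  let edge : (Fin (m + 1) → Fin t → ZMod q) → Finset (Fin n) :=
    fun x => Finset.univ.image fun k => emb (k, x k)
  have hpart : ∀ x : Fin (m + 1) → Fin t → ZMod q,
      Function.Injective fun k => emb (k, x k) := by
    intro x k k' h
    exact (Prod.mk.inj (emb.injective h)).1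
  have hedge : Function.Injective edge := by
    intro x x' h
    funext k
    have hk : emb (k, x k) ∈ edge x' := h ▸ Finset.mem_image_of_mem _ (Finset.mem_univ k)
    obtain ⟨k', -, hk'⟩ := Finset.mem_image.1 hk
    have := Prod.mk.inj (emb.injective hk')
    rw [← this.2, this.1]
  obtain ⟨b, -, hb⟩ := Finset.exists_le_card_fiber_of_mul_le_card_of_maps_to
    (s := (Finset.univ : Finset (Fin (m + 1) → Fin t → ZMod q)))
    (t := (Finset.univ : Finset (ZMod q))) (f := fun x => N (z x))
    (n := q ^ ((m + 1) * t - 1)) (fun _ _ => Finset.mem_univ _) ⟨0, Finset.mem_univ _⟩ (by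
      simp only [Finset.card_univ, ZMod.card, Fintype.card_pi, Finset.prod_const,
        Fintype.card_fin]
      rw [← pow_succ', ← pow_mul, Nat.sub_add_cancel (Nat.mul_pos (by omega) ht0), mul_comm])
  refine ⟨(Finset.univ.filter fun x => N (z x) = b).image edge, ?_, ?_, ?_⟩
  · intro f hf
    obtain ⟨x, -, rfl⟩ := Finset.mem_image.1 hf
    rw [Finset.card_image_of_injective _ (hpart x), Finset.card_univ, Fintype.card_fin]
  · rintro ⟨A, hdisj, hcard, hA⟩
    let Φ' : Fin n → GaloisField q ((m + 1) * t) := Function.extend emb Φ 0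
    have hΦ' : ∀ w, Φ' (emb w) = Φ w := fun w => emb.injective.extend_apply _ _ _
    have hidx : ∀ {i i' : Fin (m + 1)} {v : Fin n}, v ∈ A i → v ∈ A i' → i = i' := by
      intro i i' v hi hi'
      by_contra hne
      exact Finset.disjoint_left.1 (hdisj i i' hne) hi hi'
    have hx : ∀ g : Fin (m + 1) → Fin n, (∀ i, g i ∈ A i) →
        ∃ x, N (z x) = b ∧ edge x = Finset.univ.image g ∧ z x = ∑ i, Φ' (g i) := by
      intro g hg
      obtain ⟨x, hx, hxe⟩ := Finset.mem_image.1 (hA g hg)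
      refine ⟨x, (Finset.mem_filter.1 hx).2, hxe, ?_⟩
      have hginj : Function.Injective g := fun i i' h => hidx (hg i) (h ▸ hg i')
      have h1 : ∑ v ∈ edge x, Φ' v = z x := by
        rw [Finset.sum_image (hpart x).injOn]
        simp only [hΦ', z]
      rw [← h1, hxe, Finset.sum_image hginj.injOn]
    have hprod : (Fintype.piFinset fun i : Fin m => A i.castSucc).card = t := by
      rw [Fintype.card_piFinset, ht]
      refine Finset.prod_congr rfl fun i _ => ?_
      rw [hcard]
      simp
    let e := (Finset.equivFinOfCardEq hprod).symm
    have hg : ∀ j, ∀ v ∈ A (Fin.last m), ∀ i,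
        (Fin.snoc (e j : Fin m → Fin n) v : Fin (m + 1) → Fin n) i ∈ A i := by
      intro j v hv i
      refine Fin.lastCases ?_ (fun i => ?_) i
      · simpa using hv
      · simpa using Fintype.mem_piFinset.1 (e j).2 i
    have hlast : (A (Fin.last m)).card = p := by
      rw [hcard]
      simp
    let u : Fin t → GaloisField q ((m + 1) * t) := fun j => ∑ i, Φ' ((e j : Fin m → Fin n) i)
    have hsum : ∀ j v, ∑ i, Φ' ((Fin.snoc (e j : Fin m → Fin n) v : Fin (m + 1) → Fin n) i) =
        Φ' v + u j := by
      intro j v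
      rw [Fin.sum_univ_castSucc]
      simp only [Fin.snoc_castSucc, Fin.snoc_last]
      exact add_comm _ _
    have hu : Function.Injective u := by
      intro j j' h
      obtain ⟨v, hv⟩ : (A (Fin.last m)).Nonempty := Finset.card_pos.1 (by omega)
      obtain ⟨x, -, hxe, hxz⟩ := hx _ (hg j v hv)
      obtain ⟨x', -, hxe', hxz'⟩ := hx _ (hg j' v hv)
      have hxx : x = x' := hinj (hxz.trans (by rw [hsum, h, ← hsum, ← hxz']))
      subst hxx
      refine e.injective (Subtype.ext (funext fun i => ?_))
      have hmem : (e j : Fin m → Fin n) i ∈ Finset.univ.image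
          (Fin.snoc (e j' : Fin m → Fin n) v : Fin (m + 1) → Fin n) := by
        rw [← hxe', hxe]
        exact Finset.mem_image.2 ⟨i.castSucc, Finset.mem_univ _, by simp⟩
      obtain ⟨i', -, hi'⟩ := Finset.mem_image.1 hmem
      have hii : i' = i.castSucc :=
        hidx (hg j' v hv i') (hi' ▸ Fintype.mem_piFinset.1 (e j).2 i)
      rw [← hi', hii]
      simp
    let Y : Fin (m + 1) → Finset (Fin t → ZMod q) := fun k =>
      Finset.univ.filter fun y => ∀ j, N (Φ (k, y) + u j) = b
    have hY : ∀ k, (Y k).card ≤ D := fun k =>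
      hfew k u b (Y k) hu fun y hy => (Finset.mem_filter.1 hy).2
    have hsub : A (Fin.last m) ⊆
        Finset.univ.biUnion fun k => (Y k).image fun y => emb (k, y) := by
      intro v hv
      obtain ⟨x, -, hxe, -⟩ := hx _ (hg ⟨0, ht0⟩ v hv)
      have hmem : v ∈ edge x := by
        rw [hxe]
        exact Finset.mem_image.2 ⟨Fin.last m, Finset.mem_univ _, by simp⟩
      obtain ⟨k, -, rfl⟩ := Finset.mem_image.1 hmem
      refine Finset.mem_biUnion.2 ⟨k, Finset.mem_univ _, Finset.mem_image_of_mem _ ?_⟩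
      refine Finset.mem_filter.2 ⟨Finset.mem_univ _, fun j => ?_⟩
      obtain ⟨x', hx', -, hxz'⟩ := hx _ (hg j _ hv)
      rw [← hΦ', ← hsum, ← hxz', hx']
    have hle : p ≤ (m + 1) * D := by
      rw [← hlast]
      refine (Finset.card_le_card hsub).trans (Finset.card_biUnion_le.trans ?_)
      refine (Finset.sum_le_sum fun k _ => Finset.card_image_le.trans (hY k)).trans ?_
      simp
    omega
  · rwa [Finset.card_image_of_injective _ hedge]

/-- The power mean inequality over a finite type, without division. -/
lemma pow_sum_mul_card_le {ι : Type*} [Fintype ι] (f : ι → ℝ) (hf : ∀ i, 0 ≤ f i) {k : ℕ}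
    (hk : 0 < k) :
    (∑ i, f i) ^ k * (Fintype.card ι : ℝ) ≤ (Fintype.card ι : ℝ) ^ k * ∑ i, f i ^ k := by
  obtain ⟨k, rfl⟩ := Nat.exists_eq_succ_of_ne_zero hk.ne'
  have h := pow_sum_le_card_mul_sum_pow (s := Finset.univ) (f := f) (fun i _ => hf i) k
  rw [Finset.card_univ] at h
  calc (∑ i, f i) ^ (k + 1) * (Fintype.card ι : ℝ)
      ≤ ((Fintype.card ι : ℝ) ^ k * ∑ i, f i ^ (k + 1)) * (Fintype.card ι : ℝ) := by gcongr
    _ = (Fintype.card ι : ℝ) ^ (k + 1) * ∑ i, f i ^ (k + 1) := by ring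

/-- The number of homomorphic copies of a complete partite hypergraph in a weighted one is at least
what the density predicts. -/
lemma pow_sum_mul_card_pow_le_sum_prod {V : Type*} [Fintype V] [Nonempty V] :
    ∀ (m : ℕ) (s : Fin m → ℕ), (∀ i, 0 < s i) → ∀ f : (Fin m → V) → ℝ, (∀ x, 0 ≤ f x) →
      (∑ x, f x) ^ (∏ i, s i) * (Fintype.card V : ℝ) ^ (∑ i, s i) ≤
        (Fintype.card V : ℝ) ^ (m * ∏ i, s i) *
          ∑ X : (i : Fin m) → Fin (s i) → V, ∏ g : (i : Fin m) → Fin (s i),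
            f fun i => X i (g i) := by
  classical
  intro m
  induction m with
  | zero =>
    intro s _ f _
    simp only [Finset.univ_eq_empty, Finset.prod_empty, Finset.sum_empty, Fintype.sum_unique,
      Fintype.prod_unique, pow_one, pow_zero, mul_one, one_mul]
    exact le_of_eq (congrArg f (Subsingleton.elim _ _))
  | succ m ih =>
    intro s hs f hf
    set n : ℝ := (Fintype.card V : ℝ) with hn
    have hn0 : 0 < n := by positivity
    let s' : Fin m → ℕ := fun i => s i.succ
    set t' := ∏ i, s' i with ht'
    have ht0 : 0 < t' := Finset.prod_pos fun i _ => hs i.succ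
    let F : (Fin (s 0) → V) → (Fin m → V) → ℝ :=
      fun X₀ x => ∏ c, f (Fin.cons (X₀ c) x : Fin (m + 1) → V)
    have hF : ∀ X₀ x, 0 ≤ F X₀ x := fun X₀ x => Finset.prod_nonneg fun c _ => hf _
    let w : (Fin m → V) → ℝ := fun x => ∑ v, f (Fin.cons v x : Fin (m + 1) → V)
    have hw : ∀ x, 0 ≤ w x := fun x => Finset.sum_nonneg fun v _ => hf _
    have hA : ∑ x, f x = ∑ x, w x := by
      rw [← (Fin.consEquiv fun _ : Fin (m + 1) => V).sum_comp, Fintype.sum_prod_type,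
        Finset.sum_comm]
      rfl
    have hB : ∑ x, w x ^ s 0 = ∑ X₀, ∑ x, F X₀ x := by
      rw [Finset.sum_comm]
      refine Finset.sum_congr rfl fun x _ => ?_
      rw [Finset.sum_pow', Fintype.piFinset_univ]
    have hT : ∑ X : (i : Fin (m + 1)) → Fin (s i) → V, ∏ g : (i : Fin (m + 1)) → Fin (s i),
        f (fun i => X i (g i)) = ∑ X₀, ∑ X : (i : Fin m) → Fin (s' i) → V,
          ∏ g : (i : Fin m) → Fin (s' i), F X₀ fun i => X i (g i) := by
      rw [← (Fin.consEquiv fun i : Fin (m + 1) => Fin (s i) → V).sum_comp,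
        Fintype.sum_prod_type]
      refine Finset.sum_congr rfl fun X₀ _ => Finset.sum_congr rfl fun X _ => ?_
      rw [← (Fin.consEquiv fun i : Fin (m + 1) => Fin (s i)).prod_comp,
        Fintype.prod_prod_type, Finset.prod_comm]
      refine Finset.prod_congr rfl fun g _ => Finset.prod_congr rfl fun c _ => congrArg f ?_
      funext i
      refine Fin.cases ?_ (fun i => ?_) i <;> simp [Fin.consEquiv]
    have h1 : (∑ x, w x) ^ s 0 * n ^ m ≤ n ^ (m * s 0) * ∑ x, w x ^ s 0 := by
      have := pow_sum_mul_card_le w hw (hs 0)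
      simpa [pow_mul] using this
    have h2 : (∑ X₀, ∑ x, F X₀ x) ^ t' * n ^ s 0 ≤ n ^ (s 0 * t') * ∑ X₀, (∑ x, F X₀ x) ^ t' := by
      have := pow_sum_mul_card_le (fun X₀ => ∑ x, F X₀ x)
        (fun X₀ => Finset.sum_nonneg fun x _ => hF X₀ x) ht0
      simpa [pow_mul] using this
    have h3 : (∑ X₀, (∑ x, F X₀ x) ^ t') * n ^ (∑ i, s' i) ≤ n ^ (m * t') *
        ∑ X₀, ∑ X : (i : Fin m) → Fin (s' i) → V,
          ∏ g : (i : Fin m) → Fin (s' i), F X₀ fun i => X i (g i) := by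
      rw [Finset.sum_mul, Finset.mul_sum]
      exact Finset.sum_le_sum fun X₀ _ => ih s' (fun i => hs i.succ) (F X₀) (hF X₀)
    rw [hT, hA, Fin.prod_univ_succ, Fin.sum_univ_succ]
    change (∑ x, w x) ^ (s 0 * t') * n ^ (s 0 + ∑ i, s' i) ≤ n ^ ((m + 1) * (s 0 * t')) * _
    rw [← hB] at h2
    set A := ∑ x, w x
    set B := ∑ x, w x ^ s 0
    set C := ∑ X₀, (∑ x, F X₀ x) ^ t'
    set W := ∑ X₀, ∑ X : (i : Fin m) → Fin (s' i) → V,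
          ∏ g : (i : Fin m) → Fin (s' i), F X₀ fun i => X i (g i)
    have hA0 : 0 ≤ A := Finset.sum_nonneg fun x _ => hw x
    have h4 : A ^ (s 0 * t') * n ^ (m * t') ≤ n ^ (m * s 0 * t') * B ^ t' := by
      have := pow_le_pow_left₀ (by positivity) h1 t'
      simpa [mul_pow, ← pow_mul] using this
    refine le_of_mul_le_mul_right ?_ (pow_pos hn0 (m * t'))
    calc A ^ (s 0 * t') * n ^ (s 0 + ∑ i, s' i) * n ^ (m * t')
        = (A ^ (s 0 * t') * n ^ (m * t')) * (n ^ s 0 * n ^ (∑ i, s' i)) := by ring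
      _ ≤ (n ^ (m * s 0 * t') * B ^ t') * (n ^ s 0 * n ^ (∑ i, s' i)) := by gcongr
      _ = n ^ (m * s 0 * t') * (B ^ t' * n ^ s 0) * n ^ (∑ i, s' i) := by ring
      _ ≤ n ^ (m * s 0 * t') * (n ^ (s 0 * t') * C) * n ^ (∑ i, s' i) := by gcongr
      _ = n ^ (m * s 0 * t') * n ^ (s 0 * t') * (C * n ^ (∑ i, s' i)) := by ring
      _ ≤ n ^ (m * s 0 * t') * n ^ (s 0 * t') * (n ^ (m * t') * W) := by gcongr
      _ = n ^ ((m + 1) * (s 0 * t')) * W * n ^ (m * t') := by ring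

/-- Few maps fail to be injective. -/
lemma card_not_injective_mul_card_le (C V : Type*) [Fintype C] [DecidableEq C] [Fintype V]
    [DecidableEq V] :
    (Finset.univ.filter fun X : C → V => ¬ Function.Injective X).card * Fintype.card V ≤
      Fintype.card C ^ 2 * Fintype.card V ^ Fintype.card C := by
  have hpair : ∀ c d : C, c ≠ d →
      (Finset.univ.filter fun X : C → V => X c = X d).card * Fintype.card V ≤
        Fintype.card V ^ Fintype.card C := by
    intro c d hcd
    rw [← Finset.card_univ (α := V), ← Finset.card_product, Finset.card_univ (α := V),
      ← Fintype.card_fun, ← Finset.card_univ (α := C → V)]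
    refine Finset.card_le_card_of_injOn (fun P => Function.update P.1 c P.2)
      (fun _ _ => Finset.mem_coe.2 (Finset.mem_univ _)) ?_
    rintro ⟨X, v⟩ hX ⟨X', v'⟩ hX' h
    have hXc : X c = X d := by simpa using hX
    have hXc' : X' c = X' d := by simpa using hX'
    have hne : ∀ x, x ≠ c → X x = X' x := fun x hx => by
      simpa [Function.update_of_ne hx] using congrFun h x
    refine Prod.ext (funext fun x => ?_) (by simpa using congrFun h c)
    by_cases hx : x = c
    · subst hx
      exact hXc.trans ((hne d hcd.symm).trans hXc'.symm)
    · exact hne x hx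
  have hsub : (Finset.univ.filter fun X : C → V => ¬ Function.Injective X) ⊆
      (Finset.univ : Finset C).offDiag.biUnion fun P =>
        Finset.univ.filter fun X : C → V => X P.1 = X P.2 := by
    intro X hX
    have hX' := (Finset.mem_filter.1 hX).2
    simp only [Function.Injective, not_forall] at hX'
    obtain ⟨c, d, h, hne⟩ := hX'
    exact Finset.mem_biUnion.2 ⟨(c, d), by simpa using hne, by simpa using h⟩
  calc _ ≤ (∑ P ∈ (Finset.univ : Finset C).offDiag,
        (Finset.univ.filter fun X : C → V => X P.1 = X P.2).card) * Fintype.card V :=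
        Nat.mul_le_mul_right _ ((Finset.card_le_card hsub).trans Finset.card_biUnion_le)
    _ ≤ ∑ P ∈ (Finset.univ : Finset C).offDiag, Fintype.card V ^ Fintype.card C := by
        rw [Finset.sum_mul]
        exact Finset.sum_le_sum fun P hP => hpair _ _ (Finset.mem_offDiag.1 hP).2.2
    _ ≤ Fintype.card C ^ 2 * Fintype.card V ^ Fintype.card C := by
        rw [Finset.sum_const, smul_eq_mul, Finset.offDiag_card, Finset.card_univ, sq]
        exact Nat.mul_le_mul_right _ (Nat.sub_le _ _)

/-- Many common neighbours of the transversals of disjoint sets give a complete partite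
subhypergraph. -/
lemma containsCompletePartite_of_le_card {V : Type*} [Fintype V] [DecidableEq V]
    (G : Finset (Finset V)) {m : ℕ} (hG : ∀ f ∈ G, f.card = m + 1) (s : Fin m → ℕ)
    (hs : ∀ i, 0 < s i) (p : ℕ) (X : (i : Fin m) → Fin (s i) → V)
    (hX : Function.Injective fun c : (i : Fin m) × Fin (s i) => X c.1 c.2)
    (hp : p ≤ (Finset.univ.filter fun y => ∀ g : (i : Fin m) → Fin (s i),
      Finset.univ.image (Fin.snoc (fun i => X i (g i)) y : Fin (m + 1) → V) ∈ G).card) :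
    ContainsCompletePartite G
      (fun i : Fin (m + 1) => if h : (i : ℕ) < m then s ⟨i, h⟩ else p) := by
  obtain ⟨Y, hYsub, hY⟩ := Finset.exists_subset_card_eq hp
  have hYG : ∀ y ∈ Y, ∀ g : (i : Fin m) → Fin (s i),
      Finset.univ.image (Fin.snoc (fun i => X i (g i)) y : Fin (m + 1) → V) ∈ G :=
    fun y hy => (Finset.mem_filter.1 (hYsub hy)).2
  have hYX : ∀ (i : Fin m) (c : Fin (s i)), X i c ∉ Y := by
    intro i c hc
    let g : (i : Fin m) → Fin (s i) := Function.update (fun i => ⟨0, hs i⟩) i c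
    have hcard := hG _ (hYG _ hc g)
    have hinj := Finset.card_image_iff.1 (hcard.trans (by simp :
      m + 1 = (Finset.univ : Finset (Fin (m + 1))).card))
    have := hinj (Finset.mem_coe.2 (Finset.mem_univ i.castSucc))
      (Finset.mem_coe.2 (Finset.mem_univ (Fin.last m))) (by simp [g])
    exact (Fin.castSucc_lt_last i).ne this
  let A : Fin (m + 1) → Finset V :=
    Fin.snoc (α := fun _ => Finset V) (fun i => Finset.univ.image (X i)) Y
  have hAi : ∀ i : Fin m, A i.castSucc = Finset.univ.image (X i) := fun i => by simp [A]
  have hAl : A (Fin.last m) = Y := by simp [A]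
  refine ⟨A, fun i j => ?_, fun i => ?_, fun g hg => ?_⟩
  · refine Fin.lastCases ?_ (fun i => ?_) i <;> refine Fin.lastCases ?_ (fun j => ?_) j
    · exact fun h => absurd rfl h
    · intro _
      rw [hAi, hAl, Finset.disjoint_right]
      intro v hv
      obtain ⟨c, -, rfl⟩ := Finset.mem_image.1 hv
      exact hYX j c
    · intro _
      rw [hAi, hAl, Finset.disjoint_left]
      intro v hv
      obtain ⟨c, -, rfl⟩ := Finset.mem_image.1 hv
      exact hYX i c
    · intro hij
      rw [hAi, hAi, Finset.disjoint_left]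
      intro v hv hv'
      obtain ⟨c, -, rfl⟩ := Finset.mem_image.1 hv
      obtain ⟨d, -, hd⟩ := Finset.mem_image.1 hv'
      have := hX (a₁ := ⟨j, d⟩) (a₂ := ⟨i, c⟩) hd
      exact hij (congrArg Fin.castSucc (congrArg Sigma.fst this).symm)
  · refine Fin.lastCases ?_ (fun i => ?_) i
    · simpa [hAl] using hY
    · rw [hAi, Finset.card_image_of_injective]
      · simp
      · intro c d h
        simpa using hX (a₁ := ⟨i, c⟩) (a₂ := ⟨i, d⟩) h
  · have hgi : ∀ i : Fin m, ∃ c, X i c = g i.castSucc := fun i => by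
      have := hg i.castSucc
      rw [hAi] at this
      simpa using this
    choose h hh using hgi
    have hgl : g (Fin.last m) ∈ Y := hAl ▸ hg (Fin.last m)
    have heq : (Fin.snoc (fun i => X i (h i)) (g (Fin.last m)) : Fin (m + 1) → V) = g := by
      funext i
      refine Fin.lastCases ?_ (fun i => ?_) i
      · simp
      · simp [hh]
    rw [← heq]
    exact hYG _ hgl h

/-- The Kővári–Sós–Turán–Erdős bound. -/
lemma card_pow_mul_card_le_of_not_containsCompletePartite {V : Type*} [Fintype V] [DecidableEq V]
    [Nonempty V] (G : Finset (Finset V)) {m : ℕ} (hG : ∀ f ∈ G, f.card = m + 1)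
    (s : Fin m → ℕ) (hs : ∀ i, 0 < s i) (p : ℕ)
    (hfree : ¬ ContainsCompletePartite G
      (fun i : Fin (m + 1) => if h : (i : ℕ) < m then s ⟨i, h⟩ else p)) :
    (G.card : ℝ) ^ (∏ i, s i) * Fintype.card V ≤
      (p + (∑ i, s i : ℕ) ^ 2 : ℝ) * (Fintype.card V : ℝ) ^ ((m + 1) * ∏ i, s i) := by
  classical
  set n : ℝ := (Fintype.card V : ℝ) with hn
  have hn0 : 0 < n := by positivity
  set t := ∏ i, s i with ht
  set S := ∑ i, s i with hS
  let P : (Fin m → V) → V → Prop := fun x y =>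
    Finset.univ.image (Fin.snoc x y : Fin (m + 1) → V) ∈ G
  let f : V → (Fin m → V) → ℝ := fun y x => if P x y then 1 else 0
  have hf : ∀ y x, 0 ≤ f y x := fun y x => by simp only [f]; split_ifs <;> norm_num
  have hedges : (G.card : ℝ) ≤ ∑ y, ∑ x, f y x := by
    have hsub : G ⊆ (Finset.univ.filter fun q : V × (Fin m → V) => P q.2 q.1).image
        fun q => Finset.univ.image (Fin.snoc q.2 q.1 : Fin (m + 1) → V) := by
      intro e he
      let u : Fin (m + 1) → V := fun i => (e.equivFinOfCardEq (hG e he)).symm i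
      have himg : Finset.univ.image u = e := by
        ext v
        simp only [Finset.mem_image, Finset.mem_univ, true_and, u]
        refine ⟨?_, fun hv => ⟨e.equivFinOfCardEq (hG e he) ⟨v, hv⟩, by simp⟩⟩
        rintro ⟨i, rfl⟩
        exact Subtype.coe_prop _
      have hsnoc : Fin.snoc (Fin.init u) (u (Fin.last m)) = u := Fin.snoc_init_self u
      refine Finset.mem_image.2 ⟨(u (Fin.last m), Fin.init u), ?_, ?_⟩
      · simp only [Finset.mem_filter, Finset.mem_univ, true_and, P]
        rw [hsnoc, himg]
        exact he
      · simp only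
        rw [hsnoc, himg]
    have hle := (Finset.card_le_card hsub).trans Finset.card_image_le
    have hsum : ∑ y, ∑ x, f y x =
        ((Finset.univ.filter fun q : V × (Fin m → V) => P q.2 q.1).card : ℝ) := by
      rw [← Fintype.sum_prod_type']
      exact Finset.sum_boole _ _
    rw [hsum]
    exact_mod_cast hle
  let d : ((i : Fin m) → Fin (s i) → V) → ℝ := fun X =>
    ∑ y, ∏ g : (i : Fin m) → Fin (s i), f y fun i => X i (g i)
  have hd : ∀ X, d X = ((Finset.univ.filter fun y => ∀ g : (i : Fin m) → Fin (s i),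
      P (fun i => X i (g i)) y).card : ℝ) := by
    intro X
    rw [← Finset.sum_boole]
    refine Finset.sum_congr rfl fun y _ => ?_
    split_ifs with h
    · exact Finset.prod_eq_one fun g _ => if_pos (h g)
    · obtain ⟨g, hg⟩ := not_forall.1 h
      exact Finset.prod_eq_zero (Finset.mem_univ g) (if_neg hg)
  have hdn : ∀ X, d X ≤ n := fun X => by
    rw [hd, hn]
    exact_mod_cast Finset.card_le_univ _
  have hdp : ∀ X, (Function.Injective fun c : (i : Fin m) × Fin (s i) => X c.1 c.2) →
      d X ≤ p := by
    intro X hX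
    rw [hd]
    by_contra! hlt
    exact hfree (containsCompletePartite_of_le_card G hG s hs p X hX
      (by exact_mod_cast hlt.le))
  have htotal : ∑ X, d X ≤ (p + (S : ℝ) ^ 2) * n ^ S := by
    rw [← (Equiv.piCurry fun (i : Fin m) (_ : Fin (s i)) => V).sum_comp]
    have hbound : ∀ X : ((c : (i : Fin m) × Fin (s i)) → V),
        d (Equiv.piCurry (fun (i : Fin m) (_ : Fin (s i)) => V) X) ≤
          p + if ¬ Function.Injective X then n else 0 := by
      intro X
      by_cases hX : Function.Injective X
      · simpa [hX] using hdp (Equiv.piCurry (fun (i : Fin m) (_ : Fin (s i)) => V) X) hX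
      · simp only [hX, not_false_eq_true, if_true]
        exact (hdn _).trans (le_add_of_nonneg_left p.cast_nonneg)
    refine (Finset.sum_le_sum fun X _ => hbound X).trans ?_
    have hcard : Fintype.card ((i : Fin m) × Fin (s i)) = S := by simp [hS]
    have hbad := card_not_injective_mul_card_le ((i : Fin m) × Fin (s i)) V
    rw [hcard] at hbad
    have hbad' : ((Finset.univ.filter fun X : ((i : Fin m) × Fin (s i)) → V =>
        ¬ Function.Injective X).card : ℝ) * n ≤ (S : ℝ) ^ 2 * n ^ S := by
      rw [hn]
      exact_mod_cast hbad
    have hall : (Fintype.card (((i : Fin m) × Fin (s i)) → V) : ℝ) = n ^ S := by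
      rw [Fintype.card_fun, hcard, hn]
      push_cast
      rfl
    rw [Finset.sum_add_distrib, Finset.sum_const, Finset.card_univ, nsmul_eq_mul, hall,
      ← Finset.sum_filter, Finset.sum_const, nsmul_eq_mul]
    linarith
  have hmain : (∑ y, ∑ x, f y x) ^ t * n * n ^ S ≤ n ^ t * (n ^ (m * t) * ∑ X, d X) := by
    have h1 := pow_sum_mul_card_le (fun y => ∑ x, f y x)
      (fun y => Finset.sum_nonneg fun x _ => hf y x) (Finset.prod_pos fun i _ => hs i :
        0 < ∏ i, s i)
    have h2 : (∑ y, (∑ x, f y x) ^ t) * n ^ S ≤ n ^ (m * t) * ∑ X, d X := by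
      rw [Finset.sum_comm, Finset.sum_mul, Finset.mul_sum]
      exact Finset.sum_le_sum fun y _ => pow_sum_mul_card_pow_le_sum_prod m s hs (f y) (hf y)
    calc (∑ y, ∑ x, f y x) ^ t * n * n ^ S ≤ (n ^ t * ∑ y, (∑ x, f y x) ^ t) * n ^ S := by
          gcongr
      _ = n ^ t * ((∑ y, (∑ x, f y x) ^ t) * n ^ S) := by ring
      _ ≤ _ := by gcongr
  refine le_of_mul_le_mul_right ?_ (pow_pos hn0 S)
  calc (G.card : ℝ) ^ t * n * n ^ S ≤ (∑ y, ∑ x, f y x) ^ t * n * n ^ S := by gcongr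
    _ ≤ n ^ t * (n ^ (m * t) * ((p + (S : ℝ) ^ 2) * n ^ S)) := hmain.trans (by gcongr)
    _ = (p + (S : ℝ) ^ 2) * n ^ ((m + 1) * t) * n ^ S := by ring

lemma rpow_sub_one_div_pow {x : ℝ} (hx : 0 < x) (m : ℕ) {t : ℕ} (ht : 0 < t) :
    (x ^ ((m + 1 : ℝ) - 1 / (t : ℝ))) ^ t * x = x ^ ((m + 1) * t) := by
  have ht' : (t : ℝ) ≠ 0 := by positivity
  rw [← Real.rpow_natCast (x ^ _), ← Real.rpow_mul hx.le, ← Real.rpow_natCast x,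
    ← Real.rpow_add_one hx.ne']
  congr 1
  push_cast
  field_simp
  ring

/-- The upper bound on edges extracted from a bound on their power. -/
lemma le_mul_rpow_of_pow_mul_le {x y K : ℝ} (hx : 0 < x) (hK : 1 ≤ K) {m t : ℕ}
    (ht : 0 < t) (h : y ^ t * x ≤ K * x ^ ((m + 1) * t)) :
    y ≤ K * x ^ ((m + 1 : ℝ) - 1 / (t : ℝ)) := by
  refine le_of_pow_le_pow_left₀ ht.ne' (by positivity) (le_of_mul_le_mul_right ?_ hx)
  rw [mul_pow, mul_assoc, rpow_sub_one_div_pow hx m ht]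
  refine h.trans ?_
  gcongr
  exact le_self_pow₀ hK ht.ne'

/-- Every large `n` is comparable to a multiple of a `t`-th power of a prime. -/
lemma exists_prime_mul_pow_le {a t n : ℕ} (ha : 0 < a) (ht : 0 < t) (hn : a * 2 ^ t ≤ n) :
    ∃ q, q.Prime ∧ a * q ^ t ≤ n ∧ n ≤ a * 2 ^ t * q ^ t := by
  let k := Nat.findGreatest (fun k => a * (2 * k) ^ t ≤ n) n
  have hle : ∀ k, k ≤ a * (2 * k) ^ t := fun k =>
    calc k ≤ 2 * k := by omega
      _ ≤ (2 * k) ^ t := Nat.le_self_pow ht.ne' _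
      _ ≤ a * (2 * k) ^ t := Nat.le_mul_of_pos_left _ ha
  have h1 : a * (2 * 1) ^ t ≤ n := by simpa using hn
  have hk : a * (2 * k) ^ t ≤ n :=
    Nat.findGreatest_spec (P := fun k => a * (2 * k) ^ t ≤ n) ((hle 1).trans h1) h1
  have hk1 : 1 ≤ k := Nat.le_findGreatest ((hle 1).trans h1) h1
  have hlt : n < a * (2 * (k + 1)) ^ t := by
    by_contra! h
    have : k + 1 ≤ k := Nat.le_findGreatest ((hle _).trans h) h
    omega
  obtain ⟨q, hq, hkq, hqk⟩ := Nat.exists_prime_lt_and_le_two_mul k (by omega)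
  refine ⟨q, hq, le_trans (by gcongr) hk, hlt.le.trans ?_⟩
  rw [mul_assoc, ← mul_pow]
  gcongr
  exact hkq

/-- Corollary 1.2: for `s_1 ≤ ⋯ ≤ s_{r-1}` (`r = m+1`) there is `c` so that for
every `p ≥ c`, `ex(n, K^{(r)}_{s_1,…,s_{r-1},p}) = Θ(n^{r - 1/(s_1⋯s_{r-1})})`:
every `n`-vertex free hypergraph has at most `C₂ n^{…}` edges and some free
hypergraph attains `C₁ n^{…}` edges, for all large `n`. -/
theorem turan_number_complete_degenerate
    (m : ℕ) (hm : 1 ≤ m) (s : Fin m → ℕ) (hs : ∀ i, 0 < s i)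
    (hmono : Monotone s) :
    ∃ c : ℕ, ∀ p : ℕ, c ≤ p →
      ∃ C₁ C₂ : ℝ, 0 < C₁ ∧ C₁ < C₂ ∧
        ∃ n₀ : ℕ, ∀ n ≥ n₀,
          (∀ G : Finset (Finset (Fin n)),
            (∀ f ∈ G, f.card = m + 1) →
            ¬ ContainsCompletePartite G
                (fun i : Fin (m + 1) => if h : (i : ℕ) < m then s ⟨i, h⟩ else p) →
            (G.card : ℝ) ≤ C₂ * (n : ℝ) ^ ((m + 1 : ℝ) - 1 / ∏ i, (s i : ℝ))) ∧
          (∃ G : Finset (Finset (Fin n)),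
            (∀ f ∈ G, f.card = m + 1) ∧
            ¬ ContainsCompletePartite G
                (fun i : Fin (m + 1) => if h : (i : ℕ) < m then s ⟨i, h⟩ else p) ∧
            C₁ * (n : ℝ) ^ ((m + 1 : ℝ) - 1 / ∏ i, (s i : ℝ)) ≤ (G.card : ℝ)) := by
  obtain ⟨c, hc, hlower⟩ := exists_norm_hypergraph m hm s hs
  refine ⟨c, fun p hp => ?_⟩
  set t := ∏ i, s i with ht
  have ht0 : 0 < t := Finset.prod_pos fun i _ => hs i
  have htcast : ∏ i, (s i : ℝ) = (t : ℝ) := by rw [ht, Nat.cast_prod]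
  rw [htcast]
  set M : ℝ := (((m + 1) * 2 ^ t : ℕ) : ℝ) with hM
  have hM0 : 0 < M := by rw [hM]; positivity
  set θ : ℝ := (m + 1 : ℝ) - 1 / (t : ℝ) with hθ
  have hθ0 : 0 ≤ θ := by
    have : 1 / (t : ℝ) ≤ 1 := by
      rw [div_le_one (by positivity)]
      exact_mod_cast ht0
    have hm0 : (0 : ℝ) ≤ m := m.cast_nonneg
    linarith
  set K : ℝ := p + (∑ i, s i : ℕ) ^ 2 with hK
  have hK1 : 1 ≤ K := by
    have hp1 : (1 : ℝ) ≤ p := by exact_mod_cast hc.trans_le hp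
    have := sq_nonneg ((∑ i, s i : ℕ) : ℝ)
    linarith
  refine ⟨(M ^ θ)⁻¹, max K ((M ^ θ)⁻¹ + 1), by positivity,
    (lt_add_one _).trans_le (le_max_right _ _), (m + 1) * 2 ^ t, fun n hn => ?_⟩
  have hn0 : 0 < n := lt_of_lt_of_le (by positivity) hn
  have hn0' : (0 : ℝ) < n := by exact_mod_cast hn0
  refine ⟨fun G hG hfree => ?_, ?_⟩
  · have : Nonempty (Fin n) := ⟨⟨0, hn0⟩⟩
    have h := card_pow_mul_card_le_of_not_containsCompletePartite G hG s hs p hfree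
    rw [Fintype.card_fin] at h
    refine (le_mul_rpow_of_pow_mul_le hn0' hK1 ht0 h).trans ?_
    gcongr
    exact le_max_left _ _
  · obtain ⟨q, hq, hqn, hnq⟩ := exists_prime_mul_pow_le m.succ_pos ht0 hn
    obtain ⟨G, hG, hfree, hcard⟩ := hlower p hp q n hq hqn
    refine ⟨G, hG, hfree, ?_⟩
    have hq0 : (0 : ℝ) < q := by exact_mod_cast hq.pos
    have hnq' : (n : ℝ) ≤ M * (q : ℝ) ^ t := by
      rw [hM]
      exact_mod_cast hnq
    have hpow : ((q : ℝ) ^ t) ^ θ = (q : ℝ) ^ ((m + 1) * t - 1) := by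
      rw [← Real.rpow_natCast q t, ← Real.rpow_mul hq0.le, ← Real.rpow_natCast q,
        Nat.cast_sub (Nat.mul_pos m.succ_pos ht0)]
      congr 1
      have : (t : ℝ) ≠ 0 := by positivity
      rw [hθ]
      push_cast
      field_simp
    calc (M ^ θ)⁻¹ * (n : ℝ) ^ θ ≤ (M ^ θ)⁻¹ * (M * (q : ℝ) ^ t) ^ θ := by gcongr
      _ = (q : ℝ) ^ ((m + 1) * t - 1) := by
        rw [Real.mul_rpow hM0.le (by positivity), hpow, inv_mul_cancel_left₀ (by positivity)]
      _ ≤ G.card := by exact_mod_cast hcard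
end
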